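/- arXiv:math/0607004 — 7 statements merged into one kernel-verified Lean document; each statement's English description precedes it below -/
import Mathlib

section
/- Let D be a nonempty connected open subset of ℂ^n and H a group acting on D such that for each h ∈ H the map x ↦ h·x is a biholomorphic bijection of D. Let 𝓥 be a Hilbert space of holomorphic functions on D on which H acts unitarily by translations (τ_h f)(x) = f(h⁻¹·x). Assume there exists a bijection σ : D → D such that σ and σ⁻¹ are both anti-holomorphic and such that for every x ∈ D there exists h ∈ H with σ(x) = h·x (σ preserves every H-orbit). Then the ring of continuous intertwiners of 𝓥 is commutative: A ∘ B = B ∘ A for all continuous ℂ-linear maps A, B : 𝓥 → 𝓥 commuting with τ_h for every h ∈ H. -/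
open scoped ComplexInnerProductSpace

/-- Componentwise complex conjugation on `ℂⁿ`. -/
noncomputable def conjE (n : ℕ) (z : EuclideanSpace ℂ (Fin n)) : EuclideanSpace ℂ (Fin n) :=
  WithLp.toLp 2 fun i => (starRingEnd ℂ) (z i)

namespace AuxMF
open Metric Set Filter Topology

theorem aux_strong {W : Type*} [NormedAddCommGroup W] [NormedSpace ℂ W] [CompleteSpace W]
    (φ : ℂ → (W →L[ℂ] ℂ)) (U : Set ℂ) (hU : IsOpen U)
    (h : ∀ w, DifferentiableOn ℂ (fun z => φ z w) U) : DifferentiableOn ℂ φ U := by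
  intro c hc
  obtain ⟨ε, hε, hεU⟩ := Metric.isOpen_iff.1 hU c hc
  obtain ⟨R, hR, hRε⟩ : ∃ R : ℝ, 0 < R ∧ 2 * R < ε := ⟨ε / 3, by positivity, by linarith⟩
  have hsub : closedBall c (2 * R) ⊆ U := (closedBall_subset_ball hRε).trans hεU
  obtain ⟨C, hC⟩ : ∃ C, ∀ z : closedBall c (2 * R), ‖φ z‖ ≤ C := by
    apply banach_steinhaus
    intro w
    obtain ⟨C, hC⟩ := (isCompact_closedBall c (2 * R)).exists_bound_of_continuousOn
      ((h w).continuousOn.mono hsub)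
    exact ⟨C, fun z => hC z z.2⟩
  have hC0 : 0 ≤ C := (norm_nonneg _).trans (hC ⟨c, mem_closedBall_self (by positivity)⟩)
  have hbig : ∀ z ∈ closedBall c R, closedBall z R ⊆ closedBall c (2 * R) := by
    intro z hz
    apply closedBall_subset_closedBall'
    have := mem_closedBall.1 hz
    linarith
  have hlip : ∀ z ∈ closedBall c R, ∀ z' ∈ closedBall c R, ‖φ z' - φ z‖ ≤ C / R * ‖z' - z‖ := by
    intro z hz z' hz'
    refine ContinuousLinearMap.opNorm_le_bound _ (by positivity) fun w => ?_
    have := (convex_closedBall c R).norm_image_sub_le_of_norm_deriv_le (𝕜 := ℂ)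
      (f := fun z => φ z w) (C := C * ‖w‖ / R) (x := z) (y := z') ?_ ?_ hz hz'
    · calc _ ≤ _ := this
        _ = _ := by ring
    · intro x hx
      exact (h w).differentiableAt (hU.mem_nhds (hsub (hbig x hx (mem_closedBall_self hR.le))))
    · intro x hx
      apply Complex.norm_deriv_le_of_forall_mem_sphere_norm_le hR
      · apply DifferentiableOn.diffContOnCl
        rw [closure_ball x hR.ne']
        exact (h w).mono ((hbig x hx).trans hsub)
      · intro y hy
        exact (φ y).le_of_opNorm_le (hC ⟨y, hbig x hx (sphere_subset_closedBall hy)⟩) w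
  have hcont : ContinuousOn φ (closedBall c R) := by
    have : LipschitzOnWith (Real.toNNReal (C / R)) φ (closedBall c R) := by
      apply LipschitzOnWith.of_dist_le_mul
      intro x hx y hy
      rw [dist_eq_norm, dist_eq_norm, Real.coe_toNNReal _ (by positivity)]
      exact hlip y hy x hx
    exact this.continuousOn
  lift R to NNReal using hR.le
  have hci : CircleIntegrable φ c R :=
    (hcont.mono sphere_subset_closedBall).circleIntegrable R.coe_nonneg
  have hps := hasFPowerSeriesOn_cauchy_integral hci (by exact_mod_cast hR)
  have hd := hps.analyticAt.differentiableAt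
  refine (hd.congr_of_eventuallyEq ?_).differentiableWithinAt
  filter_upwards [ball_mem_nhds c hR] with w hw
  ext v
  have hv := DifferentiableOn.circleIntegral_sub_inv_smul (c := c) (R := R) (w := w)
    (f := fun z => φ z v) ((h v).mono ((closedBall_subset_closedBall (by linarith)).trans hsub)) hw
  have hint : CircleIntegrable (fun z => (z - w)⁻¹ • φ z) c R := by
    apply ContinuousOn.circleIntegrable R.coe_nonneg
    refine ContinuousOn.fun_smul ?_ ?_
    · apply ContinuousOn.inv₀ (by fun_prop)
      intro z hz h0
      rw [sub_eq_zero] at h0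
      subst h0
      rw [mem_sphere] at hz
      rw [mem_ball] at hw
      linarith
    · exact hcont.mono sphere_subset_closedBall
  have : (∮ z in C(c, R), (z - w)⁻¹ • φ z) v = ∮ z in C(c, R), (z - w)⁻¹ • φ z v := by
    unfold circleIntegral
    rw [ContinuousLinearMap.intervalIntegral_apply]
    · rfl
    · exact hint.out
  rw [smul_apply, this, hv]
  have : (2 * Real.pi * Complex.I : ℂ) ≠ 0 := by simp [Real.pi_ne_zero]
  simp only [smul_eq_mul]
  field_simp

theorem aux_pair {V : Type*} [NormedAddCommGroup V] [InnerProductSpace ℂ V] [CompleteSpace V]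
    (U : Set ℂ) (hU : IsOpen U) (A : V →L[ℂ] V) (u : ℂ → (V →L[ℂ] ℂ)) (v : ℂ → V)
    (hu : ∀ f, DifferentiableOn ℂ (fun z => u z f) U)
    (hv : ∀ f, DifferentiableOn ℂ (fun z => ⟪f, v z⟫) U) :
    DifferentiableOn ℂ (fun z => u z (A (v z))) U := by
  have h1 : DifferentiableOn ℂ (fun z => (u z).comp A) U := by
    apply aux_strong _ U hU
    intro w
    exact hu (A w)
  have h2 : DifferentiableOn ℂ (fun z => NormedSpace.inclusionInDoubleDual ℂ V (v z)) U := by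
    apply aux_strong _ U hU
    intro l
    have := hv ((InnerProductSpace.toDual ℂ V).symm l)
    simpa using this
  exact h2.clm_apply h1

/-- conj-conj composition on general spaces via real-linear maps -/
theorem aux_conj {n : ℕ} {D : Set (EuclideanSpace ℂ (Fin n))} (hD : IsOpen D)
    (f : EuclideanSpace ℂ (Fin n) → ℂ) (hf : DifferentiableOn ℂ f D)
    (σ : EuclideanSpace ℂ (Fin n) → EuclideanSpace ℂ (Fin n)) (hσ : MapsTo σ D D)
    (hσa : DifferentiableOn ℂ (fun x => conjE n (σ x)) D) :
    DifferentiableOn ℂ (fun x => (starRingEnd ℂ) (f (σ x))) D := by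
  intro x hx
  have h1 := (hσa.differentiableAt (hD.mem_nhds hx)).hasFDerivAt
  set s' := fderiv ℂ (fun x => conjE n (σ x)) x
  have h2 := (hf.differentiableAt (hD.mem_nhds (hσ hx))).hasFDerivAt
  set f' := fderiv ℂ f (σ x)
  let cL : EuclideanSpace ℂ (Fin n) →ₗ[ℝ] EuclideanSpace ℂ (Fin n) :=
    { toFun := conjE n
      map_add' := by intro a b; ext i; simp [conjE]
      map_smul' := by intro a b; ext i; simp [conjE] }
  let cC : EuclideanSpace ℂ (Fin n) →L[ℝ] EuclideanSpace ℂ (Fin n) :=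
    ⟨cL, cL.continuous_of_finiteDimensional⟩
  have hcc : ∀ y, cC (conjE n y) = y := by
    intro y; ext i; simp [cC, cL, conjE]
  have hsm : ∀ (m : ℂ) y, cC (m • y) = (starRingEnd ℂ m) • cC y := by
    intro m y; ext i; simp [cC, cL, conjE]
  have h3 : HasFDerivAt σ (cC.comp (s'.restrictScalars ℝ)) x := by
    have := cC.hasFDerivAt.comp x (h1.restrictScalars ℝ)
    refine this.congr_of_eventuallyEq (Eventually.of_forall fun y => ?_)
    exact (hcc _).symm
  have h4 := (h2.restrictScalars ℝ).comp x h3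
  have h5 := (Complex.conjCLE : ℂ →L[ℝ] ℂ).hasFDerivAt.comp x h4
  let L : EuclideanSpace ℂ (Fin n) →ₗ[ℂ] ℂ :=
    { toFun := fun y => (starRingEnd ℂ) (f' (cC (s' y)))
      map_add' := by intro a b; simp
      map_smul' := by intro a b; simp [hsm] }
  have h6 : HasFDerivAt (fun x => (starRingEnd ℂ) (f (σ x)))
      (LinearMap.toContinuousLinearMap L) x := by
    refine hasFDerivAt_of_restrictScalars ℝ h5 ?_
    ext y
    rfl
  exact h6.differentiableAt.differentiableWithinAt

theorem aux_conj1 {R : ℝ} (f : ℂ → ℂ) (hf : DifferentiableOn ℂ f (ball 0 R)) :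
    DifferentiableOn ℂ (fun z => (starRingEnd ℂ) (f ((starRingEnd ℂ) z))) (ball 0 R) := by
  intro z hz
  have hz' : (starRingEnd ℂ) z ∈ ball (0:ℂ) R := by simpa using hz
  have := (hf.differentiableAt (isOpen_ball.mem_nhds hz'))
  have h2 := this.conj_conj
  rw [Complex.conj_conj] at h2
  exact h2.differentiableWithinAt

theorem aux_ident {E : Type*} [NormedAddCommGroup E] [NormedSpace ℂ E] {D : Set E}
    (hD : IsOpen D) (hDc : IsPreconnected D) (f : E → ℂ) (hf : DifferentiableOn ℂ f D)
    (p : E) (hp : p ∈ D) (h0 : ∀ᶠ x in 𝓝 p, f x = 0) : ∀ x ∈ D, f x = 0 := by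
  have key : D ⊆ {x | ∀ᶠ y in 𝓝 x, f y = 0} := by
    apply hDc.subset_of_closure_inter_subset isOpen_setOfPred_eventually_nhds ⟨p, hp, h0⟩
    rintro x ⟨hx, hxD⟩
    obtain ⟨ε, hε, hεD⟩ := Metric.isOpen_iff.1 hD x hxD
    obtain ⟨q, hq, hqx⟩ := Metric.mem_closure_iff.1 hx ε hε
    rw [dist_comm] at hqx
    filter_upwards [ball_mem_nhds x hε] with y hy
    let l : ℂ → E := fun z => q + z • (y - q)
    have hl : Differentiable ℂ l := by fun_prop
    have hWo : IsOpen (l ⁻¹' ball x ε) := isOpen_ball.preimage hl.continuous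
    have hWc : IsPreconnected (l ⁻¹' ball x ε) := by
      apply Convex.isPreconnected
      intro z hz w hw s t hs ht hst
      have := convex_ball x ε hz hw hs ht hst
      have e : l (s • z + t • w) = s • l z + t • l w := by
        simp only [l, smul_add, add_smul]
        have hq' : q = s • q + t • q := by rw [← add_smul, hst, one_smul]
        have e1 : (s • z) • (y - q) = s • z • (y - q) := smul_assoc _ _ _
        have e2 : (t • w) • (y - q) = t • w • (y - q) := smul_assoc _ _ _
        rw [e1, e2]
        nth_rewrite 1 [hq']
        abel
      change l (s • z + t • w) ∈ ball x ε
      rw [e]; exact this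
    have hg : AnalyticOnNhd ℂ (fun z => f (l z)) (l ⁻¹' ball x ε) := by
      apply DifferentiableOn.analyticOnNhd _ hWo
      exact hf.comp hl.differentiableOn fun z hz => hεD hz
    have h00 : (0:ℂ) ∈ l ⁻¹' ball x ε := by simpa [l] using hqx
    have := hg.eqOn_zero_of_preconnected_of_eventuallyEq_zero hWc h00 ?_
      (show (1:ℂ) ∈ l ⁻¹' ball x ε by simpa [l] using hy)
    · simpa [l] using this
    · have ht : Tendsto l (𝓝 0) (𝓝 q) := by
        have := hl.continuous.tendsto 0
        simpa [l] using this
      exact ht.eventually hq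
  intro x hx
  exact (key hx).self_of_nhds

theorem aux_diag {E : Type*} [NormedAddCommGroup E] [NormedSpace ℂ E] {D : Set E}
    (hD : IsOpen D) (hDc : IsConnected D) (F : E → E → ℂ)
    (h1 : ∀ y ∈ D, DifferentiableOn ℂ (fun x => F x y) D)
    (h2 : ∀ x ∈ D, DifferentiableOn ℂ (fun y => (starRingEnd ℂ) (F x y)) D)
    (h3 : ∀ a b : E, ∀ R : ℝ, (∀ z ∈ ball (0:ℂ) R, a + z • b ∈ D) →
      DifferentiableOn ℂ (fun z : ℂ => F (a + z • b) (a + (starRingEnd ℂ z) • b)) (ball 0 R))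
    (h0 : ∀ x ∈ D, F x x = 0) : ∀ x ∈ D, ∀ y ∈ D, F x y = 0 := by
  obtain ⟨p, hp⟩ := hDc.nonempty
  obtain ⟨r, hr, hrD⟩ := Metric.isOpen_iff.1 hD p hp
  have loc : ∀ x ∈ ball p (r/4), ∀ y ∈ ball p (r/4), F x y = 0 := by
    intro x hx y hy
    let a : E := p + ((1/2 : ℂ) • (x - p) + (1/2 : ℂ) • (y - p))
    let b : E := (-Complex.I / 2) • (x - p) + (Complex.I / 2) • (y - p)
    rw [mem_ball, dist_eq_norm] at hx hy
    have hmem : ∀ z ∈ ball (0:ℂ) 2, a + z • b ∈ D := by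
      intro z hz
      apply hrD
      rw [mem_ball, dist_eq_norm]
      have hb : ‖b‖ ≤ r / 4 := by
        calc ‖b‖ ≤ _ := norm_add_le _ _
          _ = 1/2 * ‖x - p‖ + 1/2 * ‖y - p‖ := by simp [norm_smul]
          _ ≤ _ := by linarith
      have ha : ‖(1/2 : ℂ) • (x - p) + (1/2 : ℂ) • (y - p)‖ ≤ r / 4 := by
        calc _ ≤ _ := norm_add_le _ _
          _ = 1/2 * ‖x - p‖ + 1/2 * ‖y - p‖ := by simp [norm_smul]
          _ ≤ _ := by linarith
      have hz' : ‖z‖ ≤ 2 := by simpa using (mem_ball.1 hz).le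
      have e : a + z • b - p = ((1/2 : ℂ) • (x - p) + (1/2 : ℂ) • (y - p)) + z • b := by
        simp only [a]; abel
      rw [e]
      calc _ ≤ _ := norm_add_le _ _
        _ ≤ r/4 + 2 * (r/4) := by
          rw [norm_smul]; gcongr
        _ < r := by linarith
    have hd := (h3 a b 2 hmem).analyticOnNhd isOpen_ball
    have h00 : (0:ℂ) ∈ ball (0:ℂ) 2 := by simp
    have hI := hd.eqOn_zero_of_preconnected_of_frequently_eq_zero
      (convex_ball (0:ℂ) 2).isPreconnected h00 ?_ (show Complex.I ∈ ball (0:ℂ) 2 by simp)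
    · have ex : a + Complex.I • b = x := by
        simp only [a, b, smul_add, smul_sub, smul_smul]
        have i1 : Complex.I * (-Complex.I / 2) = 1/2 := by
          linear_combination (-1/2) * Complex.I_mul_I
        have i2 : Complex.I * (Complex.I / 2) = -(1/2) := by
          linear_combination (1/2) * Complex.I_mul_I
        rw [i1, i2]
        module
      have ey : a + (starRingEnd ℂ Complex.I) • b = y := by
        simp only [a, b, smul_add, smul_sub, smul_smul, Complex.conj_I]
        have i1 : -Complex.I * (-Complex.I / 2) = -(1/2) := by
          linear_combination (1/2) * Complex.I_mul_I
        have i2 : -Complex.I * (Complex.I / 2) = 1/2 := by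
          linear_combination (-1/2) * Complex.I_mul_I
        rw [i1, i2]
        module
      simp only [ex, ey] at hI
      simpa using hI
    · have ht : Tendsto (fun t : ℝ => (t:ℂ)) (𝓝[≠] 0) (𝓝[≠] 0) := by
        apply tendsto_nhdsWithin_of_tendsto_nhds_of_eventually_within
        · have : Tendsto (fun t : ℝ => (t:ℂ)) (𝓝 0) (𝓝 ((0:ℝ):ℂ)) :=
            Complex.continuous_ofReal.tendsto 0
          rw [Complex.ofReal_zero] at this
          exact this.mono_left nhdsWithin_le_nhds
        · filter_upwards [self_mem_nhdsWithin] with t ht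
          simpa using ht
      apply ht.frequently
      apply Eventually.frequently
      have : ∀ᶠ t : ℝ in 𝓝[≠] 0, (t:ℂ) ∈ ball (0:ℂ) 2 :=
        (ht.mono_right nhdsWithin_le_nhds).eventually (ball_mem_nhds _ (by norm_num))
      filter_upwards [this] with t ht
      rw [Complex.conj_ofReal]
      exact h0 _ (hmem _ ht)
  have hr4 : 0 < r / 4 := by positivity
  have hsub : ball p (r/4) ⊆ D := (ball_subset_ball (by linarith)).trans hrD
  have st1 : ∀ y ∈ ball p (r/4), ∀ x ∈ D, F x y = 0 := by
    intro y hy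
    apply aux_ident hD hDc.isPreconnected _ (h1 y (hsub hy)) p hp
    filter_upwards [ball_mem_nhds p hr4] with x hx using loc x hx y hy
  intro x hx y hy
  have := aux_ident hD hDc.isPreconnected _ (h2 x hx) p hp (by
    filter_upwards [ball_mem_nhds p hr4] with y hy
    rw [st1 y hy x hx, map_zero]) y hy
  simpa using this

noncomputable def auxG {V ι : Type*} [NormedAddCommGroup V] [InnerProductSpace ℂ V]
    (k k' : ι → V) : AddSubgroup (V × V) :=
  AddSubgroup.closure (Set.range fun p : ℂ × ι => (p.1 • k p.2, (starRingEnd ℂ p.1) • k' p.2))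

theorem auxG_sesq0 {V ι : Type*} [NormedAddCommGroup V] [InnerProductSpace ℂ V]
    (k k' : ι → V) (C : V →L[ℂ] V) (hC : ∀ i j, ⟪k' j, C (k' i)⟫ = ⟪k i, C (k j)⟫)
    (g g' : V × V) (hg : g ∈ auxG k k') (hg' : g' ∈ auxG k k') :
    ⟪g'.2, C g.2⟫ = ⟪g.1, C g'.1⟫ := by
  refine AddSubgroup.closure_induction₂ (p := fun x y _ _ => ⟪y.2, C x.2⟫ = ⟪x.1, C y.1⟫)
    ?_ ?_ ?_ ?_ ?_ ?_ ?_ hg hg'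
  · rintro _ _ ⟨⟨c, i⟩, rfl⟩ ⟨⟨d, j⟩, rfl⟩
    simp only [map_smul, inner_smul_left, inner_smul_right, hC, Complex.conj_conj]
    ring
  · intro x _; simp
  · intro x _; simp
  · intro x y z _ _ _ h1 h2; simp [inner_add_left, inner_add_right, h1, h2]
  · intro x y z _ _ _ h1 h2; simp [inner_add_left, inner_add_right, h1, h2]
  · intro x y _ _ h1; simp [h1]
  · intro x y _ _ h1; simp [h1]

theorem auxG_sesq {V ι : Type*} [NormedAddCommGroup V] [InnerProductSpace ℂ V]
    (k k' : ι → V) (C : V →L[ℂ] V) (hC : ∀ i j, ⟪k' j, C (k' i)⟫ = ⟪k i, C (k j)⟫)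
    (g g' : V × V) (hg : g ∈ (auxG k k').topologicalClosure)
    (hg' : g' ∈ (auxG k k').topologicalClosure) :
    ⟪g'.2, C g.2⟫ = ⟪g.1, C g'.1⟫ := by
  have hm : (g, g') ∈ closure ((auxG k k' : Set (V × V)) ×ˢ (auxG k k' : Set (V × V))) := by
    rw [closure_prod_eq]; exact ⟨hg, hg'⟩
  have hcl : IsClosed {q : (V × V) × (V × V) | ⟪q.2.2, C q.1.2⟫ = ⟪q.1.1, C q.2.1⟫} := by
    apply isClosed_eq <;> fun_prop
  exact closure_minimal (fun q hq => auxG_sesq0 k k' C hC q.1 q.2 hq.1 hq.2) hcl hm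

theorem auxG_proj {V ι : Type*} [NormedAddCommGroup V] [InnerProductSpace ℂ V] [CompleteSpace V]
    (k k' : ι → V) (h1 : ∀ i j, ⟪k' j, k' i⟫ = ⟪k i, k j⟫)
    (hk : ∀ v, (∀ i, ⟪k i, v⟫ = 0) → v = 0) (u : V) :
    ∃ v, (u, v) ∈ (auxG k k').topologicalClosure := by
  let G := (auxG k k').topologicalClosure
  let π : G →+ V := (AddMonoidHom.fst V V).comp G.subtype
  have hiso : Isometry π := by
    apply AddMonoidHomClass.isometry_of_norm
    rintro ⟨g, hg⟩
    have := auxG_sesq k k' (ContinuousLinearMap.id ℂ V) (by simpa using h1) g g hg hg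
    simp only [ContinuousLinearMap.id_apply, inner_self_eq_norm_sq_to_K] at this
    have h2 : ‖g.2‖ = ‖g.1‖ := by
      have h3 : ‖g.2‖ ^ 2 = ‖g.1‖ ^ 2 := by exact_mod_cast this
      exact (pow_left_inj₀ (norm_nonneg _) (norm_nonneg _) two_ne_zero).1 h3
    change ‖g.1‖ = ‖g‖
    rw [Prod.norm_def, h2, max_self]
  have hGc : IsClosed (G : Set (V × V)) := (auxG k k').isClosed_topologicalClosure
  have : CompleteSpace G := hGc.completeSpace_coe
  have hcl : IsClosed (Set.range π) := hiso.isClosedEmbedding.isClosed_range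
  have hspan : (Submodule.span ℂ (Set.range k) : Set V) ⊆ Set.range π := by
    intro x hx
    have : ∃ v, (x, v) ∈ auxG k k' := by
      refine Submodule.closure_induction (p := fun x _ => ∃ v, (x, v) ∈ auxG k k') ?_ ?_ ?_ hx
      · exact ⟨0, zero_mem _⟩
      · rintro x y _ _ ⟨v, hv⟩ ⟨w, hw⟩
        exact ⟨v + w, add_mem hv hw⟩
      · rintro c _ ⟨i, rfl⟩
        exact ⟨(starRingEnd ℂ c) • k' i, AddSubgroup.subset_closure ⟨(c, i), rfl⟩⟩
    obtain ⟨v, hv⟩ := this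
    exact ⟨⟨(x, v), (auxG k k').le_topologicalClosure hv⟩, rfl⟩
  have hdense : (Submodule.span ℂ (Set.range k)).topologicalClosure = ⊤ := by
    rw [Submodule.topologicalClosure_eq_top_iff, Submodule.eq_bot_iff]
    intro v hv
    apply hk
    intro i
    exact hv (k i) (Submodule.subset_span ⟨i, rfl⟩)
  have hu : u ∈ (Submodule.span ℂ (Set.range k)).topologicalClosure := by rw [hdense]; trivial
  obtain ⟨⟨g, hg⟩, rfl⟩ := closure_minimal hspan hcl hu
  exact ⟨g.2, hg⟩

theorem aux_comm {V ι : Type*} [NormedAddCommGroup V] [InnerProductSpace ℂ V] [CompleteSpace V]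
    (k k' : ι → V) (A B : V →L[ℂ] V)
    (hk : ∀ v, (∀ i, ⟪k i, v⟫ = 0) → v = 0) (hk' : ∀ v, (∀ i, ⟪k' i, v⟫ = 0) → v = 0)
    (h1 : ∀ i j, ⟪k' j, k' i⟫ = ⟪k i, k j⟫)
    (hA : ∀ i j, ⟪k' j, A (k' i)⟫ = ⟪k i, A (k j)⟫)
    (hB : ∀ i j, ⟪k' j, B (k' i)⟫ = ⟪k i, B (k j)⟫)
    (hAB : ∀ i j, ⟪k' j, A (B (k' i))⟫ = ⟪k i, A (B (k j))⟫) (f : V) :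
    A (B f) = B (A f) := by
  have hmem : ∀ i, (k i, k' i) ∈ (auxG k k').topologicalClosure := fun i =>
    (auxG k k').le_topologicalClosure (AddSubgroup.subset_closure ⟨(1, i), by simp⟩)
  have key : ∀ C : V →L[ℂ] V, (∀ i j, ⟪k' j, C (k' i)⟫ = ⟪k i, C (k j)⟫) →
      ∀ u v w, (u, v) ∈ (auxG k k').topologicalClosure →
      (ContinuousLinearMap.adjoint C u, w) ∈ (auxG k k').topologicalClosure → w = C v := by
    intro C hC u v w huv hw
    rw [← sub_eq_zero]
    apply hk'
    intro j
    have e1 := auxG_sesq k k' C hC _ _ huv (hmem j)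
    have e2 := auxG_sesq k k' (ContinuousLinearMap.id ℂ V) (by simpa using h1) _ _ hw (hmem j)
    simp only [ContinuousLinearMap.id_apply] at e1 e2
    rw [inner_sub_right, e1, e2, ContinuousLinearMap.adjoint_inner_left, sub_self]
  have main : ∀ i, A (B (k' i)) = B (A (k' i)) := by
    intro i
    obtain ⟨w, hw⟩ := auxG_proj k k' h1 hk (ContinuousLinearMap.adjoint A (k i))
    obtain ⟨w', hw'⟩ := auxG_proj k k' h1 hk
      (ContinuousLinearMap.adjoint B (ContinuousLinearMap.adjoint A (k i)))
    have e1 := key A hA _ _ _ (hmem i) hw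
    have e2 := key B hB _ _ _ hw hw'
    have e3 := key (A.comp B) (by simpa using hAB) _ _ w' (hmem i) (by
      rw [ContinuousLinearMap.adjoint_comp]; exact hw')
    rw [← e1, ← e2, e3]; rfl
  let C : V →L[ℂ] V := A.comp B - B.comp A
  have hC : ∀ x, ContinuousLinearMap.adjoint C x = 0 := by
    intro x
    apply hk'
    intro i
    rw [ContinuousLinearMap.adjoint_inner_right]
    simp [C, main]
  have hCf : C f = 0 := by
    rw [← inner_self_eq_zero (𝕜 := ℂ), ← ContinuousLinearMap.adjoint_inner_right, hC, inner_zero_right]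
  simpa [C, sub_eq_zero] using hCf

theorem aux_kernel {n : ℕ} (D : Set (EuclideanSpace ℂ (Fin n)))
    (hD_open : IsOpen D) (hD_conn : IsConnected D)
    {V : Type*} [NormedAddCommGroup V] [InnerProductSpace ℂ V] [CompleteSpace V]
    (k : EuclideanSpace ℂ (Fin n) → V)
    (hk : ∀ f : V, DifferentiableOn ℂ (fun x => ⟪k x, f⟫) D)
    (σ : EuclideanSpace ℂ (Fin n) → EuclideanSpace ℂ (Fin n))
    (hσ_maps : MapsTo σ D D)
    (hσ_anti : DifferentiableOn ℂ (fun x => conjE n (σ x)) D)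
    (C : V →L[ℂ] V) (h0 : ∀ x ∈ D, ⟪k (σ x), C (k (σ x))⟫ = ⟪k x, C (k x)⟫) :
    ∀ x ∈ D, ∀ y ∈ D, ⟪k (σ y), C (k (σ x))⟫ = ⟪k x, C (k y)⟫ := by
  have hkσ : ∀ f : V, DifferentiableOn ℂ (fun x => ⟪f, k (σ x)⟫) D := by
    intro f
    have := aux_conj hD_open _ (hk f) σ hσ_maps hσ_anti
    simpa only [inner_conj_symm] using this
  have hline : ∀ (a b : EuclideanSpace ℂ (Fin n)) (R : ℝ), (∀ z ∈ ball (0:ℂ) R, a + z • b ∈ D) →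
      ∀ f : EuclideanSpace ℂ (Fin n) → ℂ, DifferentiableOn ℂ f D →
      DifferentiableOn ℂ (fun z : ℂ => f (a + z • b)) (ball 0 R) := by
    intro a b R h f hf
    exact hf.comp (g := f) (f := fun z : ℂ => a + z • b)
      (Differentiable.differentiableOn (by fun_prop)) h
  have := aux_diag hD_open hD_conn
    (fun x y => ⟪k (σ y), C (k (σ x))⟫ - ⟪k x, C (k y)⟫) ?_ ?_ ?_ ?_
  · intro x hx y hy
    exact sub_eq_zero.1 (this x hx y hy)
  · intro y hy
    refine DifferentiableOn.fun_sub ?_ (hk _)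
    simpa only [ContinuousLinearMap.adjoint_inner_left] using
      hkσ (ContinuousLinearMap.adjoint C (k (σ y)))
  · intro x hx
    simp only [map_sub, inner_conj_symm]
    refine DifferentiableOn.fun_sub (hkσ _) ?_
    simpa only [ContinuousLinearMap.adjoint_inner_right] using
      hk (ContinuousLinearMap.adjoint C (k x))
  · intro a b R hR
    refine DifferentiableOn.fun_sub ?_ ?_
    · apply aux_pair (ball 0 R) isOpen_ball C
        (fun z => innerSL ℂ (k (σ (a + (starRingEnd ℂ z) • b)))) (fun z => k (σ (a + z • b)))
      · intro f
        have := aux_conj1 _ (hline a b R hR _ (hkσ f))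
        simpa only [inner_conj_symm, innerSL_apply_apply] using this
      · intro f
        exact hline a b R hR _ (hkσ f)
    · apply aux_pair (ball 0 R) isOpen_ball C
        (fun z => innerSL ℂ (k (a + z • b))) (fun z => k (a + (starRingEnd ℂ z) • b))
      · intro f
        exact hline a b R hR _ (hk f)
      · intro f
        have := aux_conj1 _ (hline a b R hR _ (hk f))
        simpa only [inner_conj_symm] using this
  · intro x hx
    exact sub_eq_zero.2 (h0 x hx)

end AuxMF

/-- **Propagation of multiplicity-freeness (trivial line bundle case).**
If a Hilbert space `𝓥` of holomorphic functions on a nonempty connected open set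
`D ⊆ ℂⁿ` carries a unitary action of `H` by translations, and if there is an
anti-holomorphic diffeomorphism `σ` of `D` preserving every `H`-orbit, then the ring of
continuous intertwiners of `𝓥` is commutative. -/
theorem multiplicity_free_of_antiholomorphic_orbit_preserving
    {n : ℕ} (D : Set (EuclideanSpace ℂ (Fin n)))
    (hD_open : IsOpen D) (hD_conn : IsConnected D)
    {H : Type*} [Group H] [MulAction H (EuclideanSpace ℂ (Fin n))]
    (hact_maps : ∀ h : H, Set.MapsTo (fun x => h • x) D D)
    (hact_hol : ∀ h : H, DifferentiableOn ℂ (fun x => h • x) D)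
    {𝓥 : Type*} [NormedAddCommGroup 𝓥] [InnerProductSpace ℂ 𝓥] [CompleteSpace 𝓥]
    (T : 𝓥 →ₗ[ℂ] (EuclideanSpace ℂ (Fin n) → ℂ))
    (hT_inj : ∀ f g : 𝓥, (∀ x ∈ D, T f x = T g x) → f = g)
    (hT_hol : ∀ f : 𝓥, DifferentiableOn ℂ (T f) D)
    (hT_eval : ∀ y ∈ D, Continuous fun f : 𝓥 => T f y)
    (τ : H → 𝓥 →ₗ[ℂ] 𝓥)
    (hτ_eval : ∀ (h : H) (f : 𝓥), ∀ x ∈ D, T (τ h f) x = T f (h⁻¹ • x))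
    (hτ_unitary : ∀ (h : H) (f g : 𝓥), ⟪τ h f, τ h g⟫ = ⟪f, g⟫)
    (hτ_surj : ∀ h : H, Function.Surjective (τ h))
    (σ σinv : EuclideanSpace ℂ (Fin n) → EuclideanSpace ℂ (Fin n))
    (hσ_maps : Set.MapsTo σ D D) (hσinv_maps : Set.MapsTo σinv D D)
    (hσ_left : ∀ x ∈ D, σinv (σ x) = x) (hσ_right : ∀ x ∈ D, σ (σinv x) = x)
    (hσ_anti : DifferentiableOn ℂ (fun x => conjE n (σ x)) D)
    (hσinv_anti : DifferentiableOn ℂ (fun x => conjE n (σinv x)) D)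
    (hσ_orbit : ∀ x ∈ D, ∃ h : H, σ x = h • x)
    (A B : 𝓥 →L[ℂ] 𝓥)
    (hA : ∀ (h : H) (f : 𝓥), A (τ h f) = τ h (A f))
    (hB : ∀ (h : H) (f : 𝓥), B (τ h f) = τ h (B f)) :
    ∀ f : 𝓥, A (B f) = B (A f) := by
  classical
  have hev : ∀ y : EuclideanSpace ℂ (Fin n), ∃ v : 𝓥, y ∈ D → ∀ f, ⟪v, f⟫ = T f y := by
    intro y
    by_cases hy : y ∈ D
    · let l : 𝓥 →L[ℂ] ℂ := ⟨(LinearMap.proj y).comp T, hT_eval y hy⟩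
      refine ⟨(InnerProductSpace.toDual ℂ 𝓥).symm l, fun _ f => ?_⟩
      rw [InnerProductSpace.toDual_symm_apply]
      rfl
    · exact ⟨0, fun h => absurd h hy⟩
  choose k hk using hev
  have hkhol : ∀ f : 𝓥, DifferentiableOn ℂ (fun x => ⟪k x, f⟫) D := fun f =>
    (hT_hol f).congr fun x hx => hk x hx f
  have hτk : ∀ (h : H), ∀ y ∈ D, τ h (k y) = k (h • y) := by
    intro h y hy
    apply ext_inner_right ℂ
    intro f
    obtain ⟨g, rfl⟩ := hτ_surj h f
    rw [hτ_unitary, hk y hy, hk _ (hact_maps h hy), hτ_eval h g _ (hact_maps h hy), inv_smul_smul]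
  have hinv : ∀ C : 𝓥 →L[ℂ] 𝓥, (∀ (h : H) (f : 𝓥), C (τ h f) = τ h (C f)) →
      ∀ x ∈ D, ∀ y ∈ D, ⟪k (σ y), C (k (σ x))⟫ = ⟪k x, C (k y)⟫ := by
    intro C hC
    refine AuxMF.aux_kernel D hD_open hD_conn k hkhol σ hσ_maps hσ_anti C ?_
    intro x hx
    obtain ⟨h, hh⟩ := hσ_orbit x hx
    rw [hh, ← hτk h x hx, hC, hτ_unitary]
  have hdense : ∀ v : 𝓥, (∀ x ∈ D, ⟪k x, v⟫ = 0) → v = 0 := by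
    intro v hv
    apply hT_inj
    intro x hx
    rw [← hk x hx, hv x hx, map_zero]
    rfl
  refine AuxMF.aux_comm (ι := D) (fun x => k x) (fun x => k (σ x)) A B ?_ ?_ ?_ ?_ ?_ ?_
  · exact fun v hv => hdense v fun x hx => hv ⟨x, hx⟩
  · refine fun v hv => hdense v fun x hx => ?_
    have := hv ⟨σinv x, hσinv_maps hx⟩
    simpa only [hσ_right x hx] using this
  · exact fun i j => hinv (ContinuousLinearMap.id ℂ 𝓥) (fun _ _ => rfl) i i.2 j j.2
  · exact fun i j => hinv A hA i i.2 j j.2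
  · exact fun i j => hinv B hB i i.2 j j.2
  · exact fun i j => hinv (A.comp B) (fun h f => by simp [hA, hB]) i i.2 j j.2
end

section
/- Let D be a nonempty connected open subset of ℂ^n and H a group acting on D such that for each h ∈ H the map x ↦ h·x is a biholomorphic bijection of D. Let 𝓥 be a Hilbert space of holomorphic functions on D on which H acts unitarily by translations (τ_h f)(x) = f(h⁻¹·x). Assume there exist: a subset S ⊆ D with H·S = D; a bijection σ : D → D such that σ and σ⁻¹ are anti-holomorphic and σ(x) = x for every x ∈ S; and a group automorphism σ̃ : H → H such that σ(h·y) = σ̃(h)·σ(y) for all h ∈ H and y ∈ D. Then the ring of continuous intertwiners of 𝓥 is commutative: A ∘ B = B ∘ A for all continuous ℂ-linear maps A, B : 𝓥 → 𝓥 commuting with τ_h for every h ∈ H. -/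
open scoped ComplexInnerProductSpace

theorem aux_lip {φ : ℂ → ℂ} {U : Set ℂ} (hU : IsOpen U) (hφ : DifferentiableOn ℂ φ U) {t₀ : ℂ} {r : ℝ}
    (hr : 0 < r) (hK : Metric.closedBall t₀ r ⊆ U) :
    ∃ C : ℝ, ∀ t ∈ Metric.closedBall t₀ r, ‖φ t - φ t₀‖ ≤ C * ‖t - t₀‖ := by
  have ht₀ : U ∈ nhds t₀ := hU.mem_nhds (hK (Metric.mem_closedBall_self hr.le))
  have h1 : ContinuousOn (dslope φ t₀) U :=
    ((Complex.differentiableOn_dslope ht₀).2 hφ).continuousOn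
  obtain ⟨C, hC⟩ := (isCompact_closedBall t₀ r).exists_bound_of_continuousOn (h1.mono hK)
  refine ⟨C, fun t ht => ?_⟩
  have := sub_smul_dslope φ t₀ t
  rw [← this, smul_eq_mul, norm_mul, mul_comm]
  exact mul_le_mul_of_nonneg_right (hC t ht) (norm_nonneg _)

theorem aux_bs {V : Type*} [NormedAddCommGroup V] [InnerProductSpace ℂ V] [CompleteSpace V]
    (a : ℂ → V) (t₀ : ℂ) (K : Set ℂ)
    (h : ∀ f : V, ∃ C : ℝ, ∀ t ∈ K, ‖⟪a t, f⟫ - ⟪a t₀, f⟫‖ ≤ C * ‖t - t₀‖) :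
    ∃ C : ℝ, ∀ t ∈ K, ‖a t - a t₀‖ ≤ C * ‖t - t₀‖ := by
  obtain ⟨C, hC⟩ := banach_steinhaus
    (g := fun t : K => innerSL ℂ (((‖(t : ℂ) - t₀‖⁻¹ : ℝ) : ℂ) • (a t - a t₀))) (by
      intro f
      obtain ⟨C, hC⟩ := h f
      refine ⟨|C|, fun t => ?_⟩
      have h1 := hC t t.2
      rw [innerSL_apply_apply, inner_smul_left, inner_sub_left, norm_mul]
      simp only [Complex.conj_ofReal, Complex.norm_real, norm_inv, norm_norm]
      by_cases h0 : ‖(t : ℂ) - t₀‖ = 0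
      · rw [h0]; simp
      · have hp : 0 < ‖(t : ℂ) - t₀‖ := lt_of_le_of_ne (norm_nonneg _) (Ne.symm h0)
        rw [inv_mul_le_iff₀ hp, mul_comm]
        exact h1.trans (mul_le_mul_of_nonneg_right (le_abs_self C) hp.le))
  refine ⟨C, fun t ht => ?_⟩
  have h1 := hC ⟨t, ht⟩
  rw [innerSL_apply_norm, norm_smul] at h1
  simp only [Complex.norm_real, norm_inv, norm_norm] at h1
  by_cases h0 : ‖t - t₀‖ = 0
  · have : t = t₀ := by simpa [sub_eq_zero] using h0
    subst this; simp
  · have hp : 0 < ‖t - t₀‖ := lt_of_le_of_ne (norm_nonneg _) (Ne.symm h0)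
    rw [inv_mul_le_iff₀ hp] at h1
    linarith

theorem aux_weak {V : Type*} [NormedAddCommGroup V] [InnerProductSpace ℂ V] [CompleteSpace V]
    (a b : ℂ → V) {U : Set ℂ} (hU : IsOpen U)
    (ha : ∀ f : V, DifferentiableOn ℂ (fun t => ⟪a t, f⟫) U)
    (hb : ∀ f : V, DifferentiableOn ℂ (fun t => ⟪f, b t⟫) U) :
    DifferentiableOn ℂ (fun t => ⟪a t, b t⟫) U := by
  intro t₀ ht₀
  obtain ⟨r, hr, hK⟩ := Metric.nhds_basis_closedBall.mem_iff.1 (hU.mem_nhds ht₀)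
  obtain ⟨C₁, h₁⟩ := aux_bs a t₀ (Metric.closedBall t₀ r) (fun f => aux_lip hU (ha f) hr hK)
  obtain ⟨C₂, h₂⟩ := aux_bs b t₀ (Metric.closedBall t₀ r) (fun f => by
    obtain ⟨C, hC⟩ := aux_lip hU (hb f) hr hK
    refine ⟨C, fun t ht => ?_⟩
    have := hC t ht
    rwa [← inner_sub_right, ← norm_inner_symm, inner_sub_left] at this)
  have hUn := hU.mem_nhds ht₀
  have d1 := (ha (b t₀)).differentiableAt hUn
  have d2 := (hb (a t₀)).differentiableAt hUn
  have d3 : HasDerivAt (fun t => ⟪a t - a t₀, b t - b t₀⟫) 0 t₀ := by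
    rw [hasDerivAt_iff_isLittleO]
    have hO : (fun t => ⟪a t - a t₀, b t - b t₀⟫) =O[nhds t₀] fun t => (t - t₀) ^ 2 := by
      refine Asymptotics.IsBigO.of_bound (C₁ * C₂) ?_
      filter_upwards [Metric.closedBall_mem_nhds t₀ hr] with t ht
      calc _ ≤ ‖a t - a t₀‖ * ‖b t - b t₀‖ := norm_inner_le_norm _ _
        _ ≤ (C₁ * ‖t - t₀‖) * (C₂ * ‖t - t₀‖) :=
          mul_le_mul (h₁ t ht) (h₂ t ht) (norm_nonneg _) ((norm_nonneg _).trans (h₁ t ht))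
        _ = _ := by rw [norm_pow]; ring
    have ho : (fun t : ℂ => (t - t₀) ^ 2) =o[nhds t₀] fun t => t - t₀ := by
      have : Filter.Tendsto (fun t : ℂ => t - t₀) (nhds t₀) (nhds 0) := by
        have : ContinuousAt (fun t : ℂ => t - t₀) t₀ := by fun_prop
        simpa [ContinuousAt] using this
      exact (Asymptotics.isLittleO_pow_id one_lt_two).comp_tendsto this
    simpa using hO.trans_isLittleO ho
  have e : (fun t => ⟪a t, b t⟫) = fun t => ⟪a t, b t₀⟫ + ⟪a t₀, b t⟫ - ⟪a t₀, b t₀⟫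
      + ⟪a t - a t₀, b t - b t₀⟫ := by
    funext t
    simp only [inner_sub_left, inner_sub_right]; ring
  rw [e]
  exact (((d1.add d2).sub_const _).add d3.differentiableAt).differentiableWithinAt

theorem aux_conv {E : Type*} [NormedAddCommGroup E] [NormedSpace ℂ E] (q v p : E) (r : ℝ)
    (c : ℂ →ₗ[ℝ] ℂ) : Convex ℝ {t : ℂ | q + c t • v ∈ Metric.ball p r} := by
  intro s hs t ht α β hα hβ hαβ
  rw [Set.mem_ofPred_eq] at hs ht ⊢
  have := (convex_ball p r) hs ht hα hβ hαβ
  have e : q + c (α • s + β • t) • v = α • (q + c s • v) + β • (q + c t • v) := by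
    have : q = (α + β) • q := by rw [hαβ, one_smul]
    conv_lhs => rw [this]
    rw [map_add, map_smul, map_smul, add_smul, add_smul, smul_add, smul_add, smul_assoc,
      smul_assoc]; abel
  rw [e]; exact this

theorem aux_ident {E : Type*} [NormedAddCommGroup E] [NormedSpace ℂ E] {D : Set E}
    (hD : IsOpen D) (hc : IsPreconnected D) (f : E → ℂ)
    (hf : ∀ q v : E, DifferentiableOn ℂ (fun t : ℂ => f (q + t • v)) {t | q + t • v ∈ D})
    {p : E} (hp : p ∈ D) (hz : ∀ᶠ x in nhds p, f x = 0) : ∀ x ∈ D, f x = 0 := by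
  set Z : Set E := {x | ∀ᶠ y in nhds x, f y = 0} with hZ
  have hZo : IsOpen Z := isOpen_setOfPred_eventually_nhds
  have key : D ⊆ Z := by
    refine hc.subset_of_closure_inter_subset hZo ⟨p, hp, hz⟩ ?_
    rintro x ⟨hx, hxD⟩
    obtain ⟨r, hr, hB⟩ := Metric.isOpen_iff.1 hD x hxD
    obtain ⟨z, hzZ, hzx⟩ := Metric.mem_closure_iff.1 hx r hr
    have hzB : z ∈ Metric.ball x r := by rwa [Metric.mem_ball, dist_comm]
    filter_upwards [Metric.ball_mem_nhds x hr] with w hw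
    set v := w - z
    set U : Set ℂ := {t | z + t • v ∈ Metric.ball x r} with hUdef
    have hcont : Continuous fun t : ℂ => z + t • v := by fun_prop
    have hUo : IsOpen U := Metric.isOpen_ball.preimage hcont
    have hUc : Convex ℝ U := aux_conv z v x r LinearMap.id
    have han : AnalyticOnNhd ℂ (fun t : ℂ => f (z + t • v)) U :=
      ((hf z v).mono fun t ht => hB ht).analyticOnNhd hUo
    have h0 : (0 : ℂ) ∈ U := by simpa [hUdef] using hzB
    have h1 : (1 : ℂ) ∈ U := by simpa [hUdef, v] using hw
    have hev : (fun t : ℂ => f (z + t • v)) =ᶠ[nhds 0] 0 := by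
      have : Filter.Tendsto (fun t : ℂ => z + t • v) (nhds 0) (nhds z) := by
        simpa using hcont.tendsto 0
      exact this.eventually hzZ
    have := han.eqOn_zero_of_preconnected_of_eventuallyEq_zero hUc.isPreconnected h0 hev h1
    simpa [v] using this
  exact fun x hx => (key hx).self_of_nhds

theorem aux_diag {E : Type*} [NormedAddCommGroup E] [NormedSpace ℂ E] {D : Set E}
    (hD : IsOpen D) (hc : IsConnected D) (G : E → E → ℂ)
    (hd : ∀ x ∈ D, G x x = 0)
    (h1 : ∀ y ∈ D, ∀ q v : E, DifferentiableOn ℂ (fun t : ℂ => G (q + t • v) y) {t | q + t • v ∈ D})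
    (h2 : ∀ x ∈ D, ∀ q v : E, DifferentiableOn ℂ
      (fun t : ℂ => (starRingEnd ℂ) (G x (q + t • v))) {t | q + t • v ∈ D})
    (h3 : ∀ q v : E, DifferentiableOn ℂ
      (fun t : ℂ => G (q + t • v) (q + (starRingEnd ℂ) t • v))
        {t | q + t • v ∈ D ∧ q + (starRingEnd ℂ) t • v ∈ D}) :
    ∀ x ∈ D, ∀ y ∈ D, G x y = 0 := by
  obtain ⟨p, hp⟩ := hc.nonempty
  obtain ⟨r, hr, hB⟩ := Metric.isOpen_iff.1 hD p hp
  have loc : ∀ x ∈ Metric.ball p r, ∀ y ∈ Metric.ball p r, G x y = 0 := by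
    intro x hx y hy
    set q : E := (2⁻¹ : ℝ) • x + (2⁻¹ : ℝ) • y with hq
    set v : E := (-Complex.I / 2) • (x - y) with hv
    have hqB : q ∈ Metric.ball p r :=
      (convex_ball p r) hx hy (by norm_num) (by norm_num) (by norm_num)
    have hq' : q = (2⁻¹ : ℂ) • x + (2⁻¹ : ℂ) • y := by
      rw [hq, ← Complex.coe_smul, ← Complex.coe_smul]; norm_num
    have ex : q + Complex.I • v = x := by
      rw [hq', hv, smul_smul]
      have : Complex.I * (-Complex.I / 2) = 2⁻¹ := by
        linear_combination (-1/2 : ℂ) * Complex.I_mul_I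
      rw [this]; module
    have ey : q + (-Complex.I) • v = y := by
      rw [hq', hv, smul_smul]
      have : -Complex.I * (-Complex.I / 2) = -2⁻¹ := by
        linear_combination (1/2 : ℂ) * Complex.I_mul_I
      rw [this]; module
    set U : Set ℂ := {t | q + t • v ∈ Metric.ball p r} ∩
      {t | q + (starRingEnd ℂ) t • v ∈ Metric.ball p r} with hUdef
    have hUc : Convex ℝ U := (aux_conv q v p r LinearMap.id).inter
      (aux_conv q v p r Complex.conjAe.toLinearMap)
    have hUo : IsOpen U := by
      refine (Metric.isOpen_ball.preimage (f := fun t : ℂ => q + t • v) (by fun_prop)).inter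
        (Metric.isOpen_ball.preimage (f := fun t : ℂ => q + (starRingEnd ℂ) t • v) ?_)
      exact continuous_const.add (Complex.continuous_conj.smul continuous_const)
    have han : AnalyticOnNhd ℂ (fun t : ℂ => G (q + t • v) (q + (starRingEnd ℂ) t • v)) U :=
      ((h3 q v).mono fun t ht => ⟨hB ht.1, hB ht.2⟩).analyticOnNhd hUo
    have h0 : (0 : ℂ) ∈ U := by simp only [hUdef, Set.mem_inter_iff, Set.mem_ofPred_eq, map_zero, zero_smul, add_zero]; exact ⟨hqB, hqB⟩
    have hI : Complex.I ∈ U := by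
      simp only [hUdef, Set.mem_inter_iff, Set.mem_ofPred_eq, Complex.conj_I, ex, ey]
      exact ⟨hx, hy⟩
    have hfr : ∃ᶠ t in nhdsWithin (0 : ℂ) {0}ᶜ,
        (fun t : ℂ => G (q + t • v) (q + (starRingEnd ℂ) t • v)) t = 0 := by
      have ht : Filter.Tendsto (fun s : ℝ => (s : ℂ)) (nhdsWithin (0 : ℝ) {0}ᶜ)
          (nhdsWithin (0 : ℂ) {0}ᶜ) := by
        refine tendsto_nhdsWithin_iff.2 ⟨?_, ?_⟩
        · have := Complex.continuous_ofReal.tendsto 0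
          rw [Complex.ofReal_zero] at this
          exact this.mono_left nhdsWithin_le_nhds
        · filter_upwards [self_mem_nhdsWithin] with s hs
          simpa using hs
      refine ht.frequently (Filter.Eventually.frequently ?_)
      have : ∀ᶠ s : ℝ in nhds 0, (s : ℂ) ∈ U := by
        have := Complex.continuous_ofReal.tendsto 0
        rw [Complex.ofReal_zero] at this
        exact this.eventually (hUo.mem_nhds h0)
      filter_upwards [nhdsWithin_le_nhds this] with s hs
      simp only [Complex.conj_ofReal]
      exact hd _ (hB hs.1)
    have := han.eqOn_zero_of_preconnected_of_frequently_eq_zero hUc.isPreconnected h0 hfr hI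
    simpa only [Complex.conj_I, ex, ey, Pi.zero_apply] using this
  have step : ∀ y ∈ Metric.ball p r, ∀ x ∈ D, G x y = 0 := fun y hy =>
    aux_ident hD hc.isPreconnected (fun x => G x y) (h1 y (hB hy)) hp (by
      filter_upwards [Metric.ball_mem_nhds p hr] with x hx using loc x hx y hy)
  intro x hx y hy
  have := aux_ident hD hc.isPreconnected (fun y => (starRingEnd ℂ) (G x y)) (h2 x hx) hp (by
      filter_upwards [Metric.ball_mem_nhds p hr] with y hy
      rw [step y hy x hx, map_zero]) y hy
  simpa using this

theorem aux_J {V : Type*} [NormedAddCommGroup V] [InnerProductSpace ℂ V] [CompleteSpace V]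
    {ι : Type*} (k k' : ι → V)
    (hk : ∀ u : V, (∀ x, ⟪k x, u⟫ = 0) → u = 0)
    (hk' : ∀ u : V, (∀ x, ⟪k' x, u⟫ = 0) → u = 0)
    (hkk : ∀ x y, ⟪k' x, k' y⟫ = (starRingEnd ℂ) ⟪k x, k y⟫)
    (u v u' v' : V) (hP : ∀ x, ⟪k' x, v⟫ = (starRingEnd ℂ) ⟪k x, u⟫)
    (hP' : ∀ x, ⟪k' x, v'⟫ = (starRingEnd ℂ) ⟪k x, u'⟫) :
    ⟪v, v'⟫ = (starRingEnd ℂ) ⟪u, u'⟫ := by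
  set P : V → V → Prop := fun u v => ∀ x, ⟪k' x, v⟫ = (starRingEnd ℂ) ⟪k x, u⟫ with hPdef
  set Q : V → V → Prop := fun u v => P u v ∧
    ∀ u' v', P u' v' → ⟪v, v'⟫ = (starRingEnd ℂ) ⟪u, u'⟫ with hQdef
  have huniq : ∀ u v v', P u v → P u v' → v = v' := by
    intro u v v' h h'
    refine sub_eq_zero.1 (hk' _ fun x => ?_)
    rw [inner_sub_right, h x, h' x, sub_self]
  have hQk : ∀ x, Q (k x) (k' x) := fun x => ⟨fun y => hkk y x, fun u' v' h => h x⟩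
  have hQadd : ∀ u v u' v', Q u v → Q u' v' → Q (u + u') (v + v') := by
    intro u v u' v' h h'
    refine ⟨fun x => ?_, fun a b hab => ?_⟩
    · rw [inner_add_right, inner_add_right, map_add, h.1 x, h'.1 x]
    · rw [inner_add_left, inner_add_left, map_add, h.2 _ _ hab, h'.2 _ _ hab]
  have hQsmul : ∀ (c : ℂ) u v, Q u v → Q (c • u) ((starRingEnd ℂ) c • v) := by
    intro c u v h
    refine ⟨fun x => ?_, fun a b hab => ?_⟩
    · rw [inner_smul_right, inner_smul_right, map_mul, h.1 x]
    · rw [inner_smul_left, inner_smul_left, map_mul, h.2 _ _ hab]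
  have hQzero : Q 0 0 := ⟨fun x => by simp, fun a b hab => by simp⟩
  have hQnorm : ∀ u v, Q u v → ‖v‖ = ‖u‖ := by
    intro u v h
    have := h.2 u v h.1
    rw [inner_self_eq_norm_sq_to_K, inner_self_eq_norm_sq_to_K] at this
    have h2 : ((‖v‖ ^ 2 : ℝ) : ℂ) = ((‖u‖ ^ 2 : ℝ) : ℂ) := by
      simpa using this
    have h3 := Complex.ofReal_injective h2
    exact (sq_eq_sq₀ (norm_nonneg _) (norm_nonneg _)).1 h3
  have hQsub : ∀ u v u' v', Q u v → Q u' v' → Q (u - u') (v - v') := by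
    intro u v u' v' h h'
    have := hQadd _ _ _ _ h (hQsmul (-1) _ _ h')
    simpa [sub_eq_add_neg] using this
  let M : Submodule ℂ V :=
    { carrier := {u | ∃ v, Q u v}
      add_mem' := by
        rintro a b ⟨v, hv⟩ ⟨w, hw⟩
        exact ⟨_, hQadd _ _ _ _ hv hw⟩
      zero_mem' := ⟨0, hQzero⟩
      smul_mem' := by
        rintro c a ⟨v, hv⟩
        exact ⟨_, hQsmul c _ _ hv⟩ }
  have hMc : IsClosed (M : Set V) := by
    refine IsSeqClosed.isClosed ?_
    intro s a hs hsa
    choose w hw using hs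
    have hcau : CauchySeq w := by
      have hsc := hsa.cauchySeq
      rw [Metric.cauchySeq_iff] at hsc ⊢
      intro ε hε
      obtain ⟨N, hN⟩ := hsc ε hε
      refine ⟨N, fun m hm n hn => ?_⟩
      have := hN m hm n hn
      rwa [dist_eq_norm, hQnorm _ _ (hQsub _ _ _ _ (hw m) (hw n)), ← dist_eq_norm]
    obtain ⟨b, hb⟩ := cauchySeq_tendsto_of_complete hcau
    refine ⟨b, fun x => ?_, fun a' b' hab => ?_⟩
    · have l1 : Filter.Tendsto (fun m => ⟪k' x, w m⟫) Filter.atTop (nhds ⟪k' x, b⟫) :=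
        tendsto_const_nhds.inner hb
      have l2 : Filter.Tendsto (fun m => (starRingEnd ℂ) ⟪k x, s m⟫) Filter.atTop
          (nhds ((starRingEnd ℂ) ⟪k x, a⟫)) :=
        (Complex.continuous_conj.tendsto _).comp (tendsto_const_nhds.inner hsa)
      refine tendsto_nhds_unique l1 (l2.congr fun m => ((hw m).1 x).symm)
    · have l1 : Filter.Tendsto (fun m => ⟪w m, b'⟫) Filter.atTop (nhds ⟪b, b'⟫) :=
        hb.inner tendsto_const_nhds
      have l2 : Filter.Tendsto (fun m => (starRingEnd ℂ) ⟪s m, a'⟫) Filter.atTop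
          (nhds ((starRingEnd ℂ) ⟪a, a'⟫)) :=
        (Complex.continuous_conj.tendsto _).comp (hsa.inner tendsto_const_nhds)
      refine tendsto_nhds_unique l1 (l2.congr fun m => ((hw m).2 _ _ hab).symm)
  have hMtop : M = ⊤ := by
    haveI : CompleteSpace M := hMc.completeSpace_coe
    rw [← Submodule.orthogonal_eq_bot_iff, eq_bot_iff]
    intro a ha
    rw [Submodule.mem_bot]
    refine hk a fun x => ?_
    exact (Submodule.mem_orthogonal M a).1 ha (k x) ⟨k' x, hQk x⟩
  obtain ⟨w, hw⟩ : u ∈ M := by rw [hMtop]; trivial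
  have : w = v := huniq u w v hw.1 hP
  subst this
  exact hw.2 _ _ hP'

theorem aux_cc {φ ψ : ℂ → ℂ} {U W : Set ℂ} (hU : IsOpen U) (h : DifferentiableOn ℂ φ U)
    (hW : ∀ t ∈ W, (starRingEnd ℂ) t ∈ U)
    (he : ∀ t, ψ t = (starRingEnd ℂ) (φ ((starRingEnd ℂ) t))) : DifferentiableOn ℂ ψ W := by
  intro t ht
  have h1 := (h.differentiableAt (hU.mem_nhds (hW t ht))).conj_conj
  have e : ψ = (starRingEnd ℂ) ∘ φ ∘ (starRingEnd ℂ) := funext he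
  rw [e]
  simpa using h1.differentiableWithinAt

/-- **Propagation of multiplicity-freeness for `S`-visible actions with a compatible
automorphism.** If a Hilbert space `𝓥` of holomorphic functions on a nonempty connected
open set `D ⊆ ℂⁿ` carries a unitary action of `H` by translations, and the `H`-action on
`D` is `S`-visible (`H · S = D`, `σ` anti-holomorphic fixing `S` pointwise) with a
compatible group automorphism `σ̃` of `H`, then the ring of continuous intertwiners of
`𝓥` is commutative. -/
theorem multiplicity_free_of_S_visible
    {n : ℕ} (D : Set (EuclideanSpace ℂ (Fin n)))
    (hD_open : IsOpen D) (hD_conn : IsConnected D)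
    {H : Type*} [Group H] [MulAction H (EuclideanSpace ℂ (Fin n))]
    (hact_maps : ∀ h : H, Set.MapsTo (fun x => h • x) D D)
    (hact_hol : ∀ h : H, DifferentiableOn ℂ (fun x => h • x) D)
    {𝓥 : Type*} [NormedAddCommGroup 𝓥] [InnerProductSpace ℂ 𝓥] [CompleteSpace 𝓥]
    (T : 𝓥 →ₗ[ℂ] (EuclideanSpace ℂ (Fin n) → ℂ))
    (hT_inj : ∀ f g : 𝓥, (∀ x ∈ D, T f x = T g x) → f = g)
    (hT_hol : ∀ f : 𝓥, DifferentiableOn ℂ (T f) D)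
    (hT_eval : ∀ y ∈ D, Continuous fun f : 𝓥 => T f y)
    (τ : H → 𝓥 →ₗ[ℂ] 𝓥)
    (hτ_eval : ∀ (h : H) (f : 𝓥), ∀ x ∈ D, T (τ h f) x = T f (h⁻¹ • x))
    (hτ_unitary : ∀ (h : H) (f g : 𝓥), ⟪τ h f, τ h g⟫ = ⟪f, g⟫)
    (hτ_surj : ∀ h : H, Function.Surjective (τ h))
    (S : Set (EuclideanSpace ℂ (Fin n))) (hS_sub : S ⊆ D)
    (hHS : ∀ x ∈ D, ∃ (h : H) (s : EuclideanSpace ℂ (Fin n)), s ∈ S ∧ x = h • s)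
    (σ σinv : EuclideanSpace ℂ (Fin n) → EuclideanSpace ℂ (Fin n))
    (hσ_maps : Set.MapsTo σ D D) (hσinv_maps : Set.MapsTo σinv D D)
    (hσ_left : ∀ x ∈ D, σinv (σ x) = x) (hσ_right : ∀ x ∈ D, σ (σinv x) = x)
    (hσ_anti : DifferentiableOn ℂ (fun x => conjE n (σ x)) D)
    (hσinv_anti : DifferentiableOn ℂ (fun x => conjE n (σinv x)) D)
    (hσ_fix : ∀ x ∈ S, σ x = x)
    (σt : H ≃* H)
    (hcompat : ∀ (h : H), ∀ y ∈ D, σ (h • y) = σt h • σ y)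
    (A B : 𝓥 →L[ℂ] 𝓥)
    (hA : ∀ (h : H) (f : 𝓥), A (τ h f) = τ h (A f))
    (hB : ∀ (h : H) (f : 𝓥), B (τ h f) = τ h (B f)) :
    ∀ f : 𝓥, A (B f) = B (A f) := by
  classical
  intro f
  have hex : ∀ x, ∃ k : 𝓥, x ∈ D → ∀ f : 𝓥, ⟪k, f⟫ = T f x := by
    intro x
    by_cases hx : x ∈ D
    · let L : 𝓥 →L[ℂ] ℂ := ⟨(LinearMap.proj x).comp T, hT_eval x hx⟩
      refine ⟨(InnerProductSpace.toDual ℂ 𝓥).symm L, fun _ f => ?_⟩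
      rw [InnerProductSpace.toDual_symm_apply]; rfl
    · exact ⟨0, fun h => absurd h hx⟩
  choose k hk using hex
  have hk2 : ∀ x ∈ D, ∀ f : 𝓥, ⟪f, k x⟫ = (starRingEnd ℂ) (T f x) := by
    intro x hx f
    rw [← inner_conj_symm, hk x hx]
  have hkτ : ∀ (h : H), ∀ x ∈ D, k (h • x) = τ h (k x) := by
    intro h x hx
    refine ext_inner_right ℂ fun g => ?_
    obtain ⟨g, rfl⟩ := hτ_surj h g
    rw [hτ_unitary, hk _ (hact_maps h hx), hk x hx, hτ_eval h g _ (hact_maps h hx),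
      inv_smul_smul]
  have hzero : ∀ u : 𝓥, (∀ x ∈ D, ⟪k x, u⟫ = 0) → u = 0 := by
    intro u hu
    refine hT_inj u 0 fun x hx => ?_
    rw [← hk x hx, hu x hx, map_zero]; rfl
  -- opens
  have cont1 : ∀ q v : EuclideanSpace ℂ (Fin n), Continuous fun t : ℂ => q + t • v :=
    fun q v => by fun_prop
  have cont2 : ∀ q v : EuclideanSpace ℂ (Fin n),
      Continuous fun t : ℂ => q + (starRingEnd ℂ) t • v :=
    fun q v => continuous_const.add (Complex.continuous_conj.smul continuous_const)
  have op1 : ∀ q v : EuclideanSpace ℂ (Fin n), IsOpen {t : ℂ | q + t • v ∈ D} :=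
    fun q v => hD_open.preimage (cont1 q v)
  have op2 : ∀ q v : EuclideanSpace ℂ (Fin n),
      IsOpen {t : ℂ | q + (starRingEnd ℂ) t • v ∈ D} :=
    fun q v => hD_open.preimage (cont2 q v)
  have line : ∀ q v : EuclideanSpace ℂ (Fin n), Differentiable ℂ fun t : ℂ => q + t • v :=
    fun q v => by fun_prop
  have f1 : ∀ (f : 𝓥) (q v : EuclideanSpace ℂ (Fin n)),
      DifferentiableOn ℂ (fun t : ℂ => T f (q + t • v)) {t | q + t • v ∈ D} :=
    fun f q v => (hT_hol f).comp (line q v).differentiableOn fun t ht => ht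
  have f2 : ∀ (f : 𝓥) (q v : EuclideanSpace ℂ (Fin n)),
      DifferentiableOn ℂ (fun t : ℂ => (starRingEnd ℂ) (T f (q + (starRingEnd ℂ) t • v)))
        {t | q + (starRingEnd ℂ) t • v ∈ D} :=
    fun f q v => aux_cc (op1 q v) (f1 f q v) (fun t ht => ht) fun t => rfl
  have s1 : ∀ (q v : EuclideanSpace ℂ (Fin n)),
      DifferentiableOn ℂ (fun t : ℂ => σ (q + (starRingEnd ℂ) t • v))
        {t | q + (starRingEnd ℂ) t • v ∈ D} := by
    intro q v
    rw [differentiableOn_euclidean]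
    intro i
    have h1 : DifferentiableOn ℂ (fun t : ℂ => conjE n (σ (q + t • v))) {t | q + t • v ∈ D} :=
      hσ_anti.comp (line q v).differentiableOn fun t ht => ht
    have h2 := differentiableOn_euclidean.1 h1 i
    exact aux_cc (op1 q v) h2 (fun t ht => ht) fun t => by simp [conjE]
  have f3 : ∀ (f : 𝓥) (q v : EuclideanSpace ℂ (Fin n)),
      DifferentiableOn ℂ (fun t : ℂ => T f (σ (q + (starRingEnd ℂ) t • v)))
        {t | q + (starRingEnd ℂ) t • v ∈ D} :=
    fun f q v => (hT_hol f).comp (s1 q v) fun t ht => hσ_maps ht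
  have f4 : ∀ (f : 𝓥) (q v : EuclideanSpace ℂ (Fin n)),
      DifferentiableOn ℂ (fun t : ℂ => (starRingEnd ℂ) (T f (σ (q + t • v))))
        {t | q + t • v ∈ D} :=
    fun f q v => aux_cc (op2 q v) (f3 f q v) (fun t ht => by simpa using ht)
      fun t => by simp
  -- the kernel identity
  have key : ∀ A : 𝓥 →L[ℂ] 𝓥, (∀ (h : H) (f : 𝓥), A (τ h f) = τ h (A f)) →
      ∀ x ∈ D, ∀ y ∈ D, ⟪k (σ y), A (k (σ x))⟫ = ⟪k x, A (k y)⟫ := by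
    intro A hA x hx y hy
    have adj : ∀ f g : 𝓥, ⟪f, A g⟫ = ⟪(ContinuousLinearMap.adjoint A) f, g⟫ := fun f g =>
      (ContinuousLinearMap.adjoint_inner_left A g f).symm
    have adj2 : ∀ f g : 𝓥, (starRingEnd ℂ) ⟪f, A g⟫ = ⟪g, (ContinuousLinearMap.adjoint A) f⟫ :=
      fun f g => by rw [adj, inner_conj_symm]
    have := aux_diag hD_open hD_conn (fun x y => ⟪k (σ y), A (k (σ x))⟫ - ⟪k x, A (k y)⟫)
      ?_ ?_ ?_ ?_ x hx y hy
    · exact sub_eq_zero.1 this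
    · intro x hx
      obtain ⟨h, s, hs, rfl⟩ := hHS x hx
      have hsD := hS_sub hs
      have e : ∀ h : H, ⟪k (h • s), A (k (h • s))⟫ = ⟪k s, A (k s)⟫ := by
        intro h
        rw [hkτ h s hsD, hA, hτ_unitary]
      rw [hcompat h s hsD, hσ_fix s hs, e, e, sub_self]
    · intro y hy q v
      refine DifferentiableOn.sub ?_ ?_
      · refine (f4 (ContinuousLinearMap.adjoint A (k (σ y))) q v).congr fun t ht => ?_
        rw [adj, hk2 _ (hσ_maps ht)]
      · exact (f1 (A (k y)) q v).congr fun t ht => hk _ ht _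
    · intro x hx q v
      simp only [map_sub]
      refine DifferentiableOn.sub ?_ ?_
      · refine (f4 (A (k (σ x))) q v).congr fun t ht => ?_
        rw [hk _ (hσ_maps ht)]
      · refine (f1 (ContinuousLinearMap.adjoint A (k x)) q v).congr fun t ht => ?_
        rw [adj2, hk _ ht]
    · intro q v
      have hop := (op1 q v).inter (op2 q v)
      refine DifferentiableOn.sub ?_ ?_
      · refine aux_weak _ _ hop (fun f => ?_) (fun f => ?_)
        · exact ((f3 f q v).mono fun t ht => ht.2).congr fun t ht => hk _ (hσ_maps ht.2) _
        · refine ((f4 (ContinuousLinearMap.adjoint A f) q v).mono fun t ht => ht.1).congr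
            fun t ht => ?_
          rw [adj, hk2 _ (hσ_maps ht.1)]
      · refine aux_weak _ _ hop (fun f => ?_) (fun f => ?_)
        · exact ((f1 f q v).mono fun t ht => ht.1).congr fun t ht => hk _ ht.1 _
        · refine ((f2 (ContinuousLinearMap.adjoint A f) q v).mono fun t ht => ht.2).congr
            fun t ht => ?_
          rw [adj, hk2 _ ht.2]
  have keyA := key A hA
  have keyB := key B hB
  have keyAB := key (A.comp B) (fun h f => by simp [hA, hB])
  have key1 := key (ContinuousLinearMap.id ℂ 𝓥) (fun h f => rfl)
  have comm : ∀ x ∈ D, ∀ y ∈ D, ⟪k x, A (B (k y))⟫ = ⟪k x, B (A (k y))⟫ := by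
    intro x hx y hy
    have h := aux_J (ι := D) (fun x => k x) (fun x => k (σ x))
      (fun u hu => hzero u fun x hx => hu ⟨x, hx⟩)
      (fun u hu => hzero u fun x hx => by
        have := hu ⟨σinv x, hσinv_maps hx⟩
        simpa only [hσ_right x hx] using this)
      (fun x y => by
        rw [inner_conj_symm]
        exact key1 y y.2 x x.2)
      (A (k y)) (ContinuousLinearMap.adjoint A (k (σ y)))
      (ContinuousLinearMap.adjoint B (k x)) (B (k (σ x)))
      (fun z => by
        rw [ContinuousLinearMap.adjoint_inner_right, ← keyA z z.2 y hy, inner_conj_symm])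
      (fun z => by
        rw [ContinuousLinearMap.adjoint_inner_right, inner_conj_symm]
        exact keyB x hx z z.2)
    rw [ContinuousLinearMap.adjoint_inner_left, inner_conj_symm,
      ContinuousLinearMap.adjoint_inner_left] at h
    rw [← h]
    exact (keyAB x hx y hy).symm
  -- pass from the kernel vectors to all vectors
  have comm2 : ∀ x ∈ D, ContinuousLinearMap.adjoint B (ContinuousLinearMap.adjoint A (k x)) =
      ContinuousLinearMap.adjoint A (ContinuousLinearMap.adjoint B (k x)) := by
    intro x hx
    refine sub_eq_zero.1 (hzero _ fun y hy => ?_)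
    rw [inner_sub_right, sub_eq_zero]
    simp only [ContinuousLinearMap.adjoint_inner_right]
    rw [← inner_conj_symm, comm x hx y hy, inner_conj_symm]
  refine sub_eq_zero.1 (hzero _ fun x hx => ?_)
  rw [inner_sub_right, sub_eq_zero]
  have := congrArg (fun w => ⟪w, f⟫) (comm2 x hx)
  simpa only [ContinuousLinearMap.adjoint_inner_left] using this
end

section
/- Let D be a nonempty connected open subset of ℂ^n and H a group acting on D such that for each h ∈ H the map x ↦ h·x is a biholomorphic bijection of D, and assume the action of H on D is transitive. Let 𝓥₁ and 𝓥₂ each be a nonzero Hilbert space of holomorphic functions on D on which H acts unitarily by translations (τ_h f)(x) = f(h⁻¹·x). Then 𝓥₁ = 𝓥₂ as sets of functions, and there exists a real constant c > 0 such that ⟨f, g⟩₂ = c·⟨f, g⟩₁ for all f, g; in particular the two unitary representations of H are unitarily equivalent. -/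
open scoped ComplexInnerProductSpace

lemma aux_const
    {n : ℕ} (D : Set (EuclideanSpace ℂ (Fin n)))
    (hD_open : IsOpen D) (hD_conn : IsConnected D)
    {H : Type*} [Group H] [MulAction H (EuclideanSpace ℂ (Fin n))]
    (htrans : ∀ x ∈ D, ∀ y ∈ D, ∃ h : H, h • x = y)
    {V : Type*} [NormedAddCommGroup V] [InnerProductSpace ℂ V] [CompleteSpace V]
    (T : V →ₗ[ℂ] (EuclideanSpace ℂ (Fin n) → ℂ))
    (hT_inj : ∀ f g : V, (∀ x ∈ D, T f x = T g x) → f = g)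
    (hT_hol : ∀ f : V, DifferentiableOn ℂ (T f) D)
    (hT_eval : ∀ y ∈ D, Continuous fun f : V => T f y)
    (τ : H → V →ₗ[ℂ] V)
    (hτ_eval : ∀ (h : H) (f : V), ∀ x ∈ D, T (τ h f) x = T f (h⁻¹ • x))
    (hτ_unitary : ∀ (h : H) (f g : V), ⟪τ h f, τ h g⟫ = ⟪f, g⟫)
    (hτ_surj : ∀ h : H, Function.Surjective (τ h))
    (hne : ∃ f : V, f ≠ 0) :
    ∃ e : V, e ≠ 0 ∧ (∀ x ∈ D, T e x = 1) ∧ ∀ (f : V), ∀ x ∈ D, f = T f x • e := by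
  have hk : ∀ y : EuclideanSpace ℂ (Fin n), ∃ k : V, y ∈ D → ∀ f : V, T f y = ⟪k, f⟫ := by
    intro y
    by_cases hy : y ∈ D
    · let φ : V →L[ℂ] ℂ := ⟨(LinearMap.proj y).comp T, hT_eval y hy⟩
      refine ⟨(InnerProductSpace.toDual ℂ V).symm φ, fun _ f => ?_⟩
      rw [InnerProductSpace.toDual_symm_apply]
      rfl
    · exact ⟨0, fun h => absurd h hy⟩
  choose k hk using hk
  have hnorm : ∀ x ∈ D, ∀ y ∈ D, ‖k x‖ = ‖k y‖ := by
    intro x hx y hy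
    obtain ⟨h, rfl⟩ := htrans x hx y hy
    have h1 : k (h • x) = τ h (k x) := by
      refine ext_inner_right ℂ fun f => ?_
      obtain ⟨g, rfl⟩ := hτ_surj h f
      rw [hτ_unitary, ← hk _ hy, ← hk _ hx, hτ_eval _ _ _ hy, inv_smul_smul]
    have h2 := hτ_unitary h (k x) (k x)
    rw [← h1, inner_self_eq_norm_sq_to_K, inner_self_eq_norm_sq_to_K] at h2
    have h3 : ‖k (h • x)‖ ^ 2 = ‖k x‖ ^ 2 := by exact_mod_cast h2
    exact ((sq_eq_sq₀ (norm_nonneg _) (norm_nonneg _)).1 h3).symm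
  have hkk : ∀ y ∈ D, ∀ x ∈ D, k x = k y := by
    intro y hy x hx
    have hyy : T (k y) y = ((‖k y‖ : ℂ)) ^ 2 := by
      rw [hk y hy, inner_self_eq_norm_sq_to_K]; rfl
    have hmax : IsMaxOn (norm ∘ T (k y)) D y := by
      intro z hz
      simp only [Set.mem_setOf_eq, Function.comp]
      rw [hyy, hk z hz]
      refine (norm_inner_le_norm _ _).trans ?_
      rw [hnorm z hz y hy]
      simp [sq]
    have h1 := Complex.eqOn_of_isPreconnected_of_isMaxOn_norm hD_conn.isPreconnected hD_open
      (hT_hol (k y)) hy hmax hx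
    simp only [Function.const_apply] at h1
    rw [hyy, hk x hx] at h1
    have h2 : ⟪k y, k x⟫ = ((‖k y‖ : ℂ)) ^ 2 := by
      rw [← inner_conj_symm, h1]; simp
    rw [← sub_eq_zero, ← inner_self_eq_zero (𝕜 := ℂ)]
    rw [inner_sub_left, inner_sub_right, inner_sub_right, h1, h2,
      inner_self_eq_norm_sq_to_K, inner_self_eq_norm_sq_to_K, hnorm x hx y hy]
    simp
  have hconst : ∀ f : V, ∀ x ∈ D, ∀ y ∈ D, T f x = T f y := by
    intro f x hx y hy
    rw [hk x hx, hk y hy, hkk y hy x hx]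
  obtain ⟨f, hf⟩ := hne
  obtain ⟨y, hy⟩ := hD_conn.nonempty
  have hfy : T f y ≠ 0 := by
    intro h0
    apply hf
    apply hT_inj
    intro x hx
    rw [hconst f x hx y hy, h0]; simp
  refine ⟨(T f y)⁻¹ • f, smul_ne_zero (inv_ne_zero hfy) hf, ?_, ?_⟩
  · intro x hx
    simp [hconst f x hx y hy, hfy]
  · intro g x hx
    apply hT_inj
    intro z hz
    simp [hconst f z hz y hy, hfy, hconst g z hz x hx]

/-- **Uniqueness of the unitary structure for transitive actions.** If the group `H` acts
transitively and biholomorphically on a nonempty connected open set `D ⊆ ℂⁿ`, and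
`𝓥₁`, `𝓥₂` are nonzero Hilbert spaces of holomorphic functions on `D` on which `H`
acts unitarily by translations, then `𝓥₁ = 𝓥₂` as sets of functions on `D` and the two
inner products are positive real multiples of one another; in particular the two unitary
representations of `H` are unitarily equivalent. -/
theorem unique_unitary_structure_of_transitive
    {n : ℕ} (D : Set (EuclideanSpace ℂ (Fin n)))
    (hD_open : IsOpen D) (hD_conn : IsConnected D)
    {H : Type*} [Group H] [MulAction H (EuclideanSpace ℂ (Fin n))]
    (hact_maps : ∀ h : H, Set.MapsTo (fun x => h • x) D D)
    (hact_hol : ∀ h : H, DifferentiableOn ℂ (fun x => h • x) D)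
    (htrans : ∀ x ∈ D, ∀ y ∈ D, ∃ h : H, h • x = y)
    {𝓥₁ : Type*} [NormedAddCommGroup 𝓥₁] [InnerProductSpace ℂ 𝓥₁] [CompleteSpace 𝓥₁]
    {𝓥₂ : Type*} [NormedAddCommGroup 𝓥₂] [InnerProductSpace ℂ 𝓥₂] [CompleteSpace 𝓥₂]
    (T₁ : 𝓥₁ →ₗ[ℂ] (EuclideanSpace ℂ (Fin n) → ℂ))
    (T₂ : 𝓥₂ →ₗ[ℂ] (EuclideanSpace ℂ (Fin n) → ℂ))
    (hT₁_inj : ∀ f g : 𝓥₁, (∀ x ∈ D, T₁ f x = T₁ g x) → f = g)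
    (hT₂_inj : ∀ f g : 𝓥₂, (∀ x ∈ D, T₂ f x = T₂ g x) → f = g)
    (hT₁_hol : ∀ f : 𝓥₁, DifferentiableOn ℂ (T₁ f) D)
    (hT₂_hol : ∀ f : 𝓥₂, DifferentiableOn ℂ (T₂ f) D)
    (hT₁_eval : ∀ y ∈ D, Continuous fun f : 𝓥₁ => T₁ f y)
    (hT₂_eval : ∀ y ∈ D, Continuous fun f : 𝓥₂ => T₂ f y)
    (τ₁ : H → 𝓥₁ →ₗ[ℂ] 𝓥₁) (τ₂ : H → 𝓥₂ →ₗ[ℂ] 𝓥₂)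
    (hτ₁_eval : ∀ (h : H) (f : 𝓥₁), ∀ x ∈ D, T₁ (τ₁ h f) x = T₁ f (h⁻¹ • x))
    (hτ₂_eval : ∀ (h : H) (f : 𝓥₂), ∀ x ∈ D, T₂ (τ₂ h f) x = T₂ f (h⁻¹ • x))
    (hτ₁_unitary : ∀ (h : H) (f g : 𝓥₁), ⟪τ₁ h f, τ₁ h g⟫ = ⟪f, g⟫)
    (hτ₂_unitary : ∀ (h : H) (f g : 𝓥₂), ⟪τ₂ h f, τ₂ h g⟫ = ⟪f, g⟫)
    (hτ₁_surj : ∀ h : H, Function.Surjective (τ₁ h))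
    (hτ₂_surj : ∀ h : H, Function.Surjective (τ₂ h))
    (hne₁ : ∃ f : 𝓥₁, f ≠ 0) (hne₂ : ∃ f : 𝓥₂, f ≠ 0) :
    (∀ f₁ : 𝓥₁, ∃ f₂ : 𝓥₂, ∀ x ∈ D, T₁ f₁ x = T₂ f₂ x) ∧
    (∀ f₂ : 𝓥₂, ∃ f₁ : 𝓥₁, ∀ x ∈ D, T₁ f₁ x = T₂ f₂ x) ∧
    ∃ c : ℝ, 0 < c ∧ ∀ (f g : 𝓥₁) (f' g' : 𝓥₂),
      (∀ x ∈ D, T₁ f x = T₂ f' x) → (∀ x ∈ D, T₁ g x = T₂ g' x) →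
      ⟪f', g'⟫ = (c : ℂ) * ⟪f, g⟫ := by
  obtain ⟨e₁, he₁, hT1, hs1⟩ := aux_const D hD_open hD_conn htrans T₁ hT₁_inj hT₁_hol hT₁_eval τ₁
    hτ₁_eval hτ₁_unitary hτ₁_surj hne₁
  obtain ⟨e₂, he₂, hT2, hs2⟩ := aux_const D hD_open hD_conn htrans T₂ hT₂_inj hT₂_hol hT₂_eval τ₂
    hτ₂_eval hτ₂_unitary hτ₂_surj hne₂
  obtain ⟨y, hy⟩ := hD_conn.nonempty
  refine ⟨fun f => ⟨T₁ f y • e₂, fun x hx => ?_⟩, fun f => ⟨T₂ f y • e₁, fun x hx => ?_⟩,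
    ‖e₂‖ ^ 2 / ‖e₁‖ ^ 2, ?_, ?_⟩
  · rw [hs1 f y hy]
    simp [hT1 x hx, hT2 x hx, hT1 y hy]
  · rw [hs2 f y hy]
    simp [hT1 x hx, hT2 x hx, hT2 y hy]
  · have := norm_pos_iff.2 he₁
    have := norm_pos_iff.2 he₂
    positivity
  · intro f g f' g' hf hg
    rw [hs1 f y hy, hs1 g y hy, hs2 f' y hy, hs2 g' y hy, ← hf y hy, ← hg y hy]
    have h1 : (‖e₁‖ : ℂ) ≠ 0 := by simpa using he₁
    simp only [inner_smul_left, inner_smul_right, inner_self_eq_norm_sq_to_K]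
    push_cast
    simp only [Complex.coe_algebraMap]
    field_simp
end

section
/- Let D be a nonempty connected open subset of ℂ^n and H a group acting on D such that for each h ∈ H the map x ↦ h·x is a biholomorphic bijection of D. Let 𝓥 be a Hilbert space of holomorphic functions on D on which H acts unitarily by translations (τ_h f)(x) = f(h⁻¹·x). Let σ : D → D be a bijection such that σ and σ⁻¹ are anti-holomorphic and such that for every x ∈ D there exists h ∈ H with σ(x) = h·x. Define (Jf)(x) := conj(f(σ(x))). Then Jf ∈ 𝓥 for every f ∈ 𝓥, the map J : 𝓥 → 𝓥 is bijective, and ⟨Jf, Jg⟩ = ⟨g, f⟩ for all f, g ∈ 𝓥; in particular J is a conjugate-linear isometry of 𝓥 onto itself. -/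
open scoped ComplexInnerProductSpace

lemma weakstar_continuousAt {V : Type*} [NormedAddCommGroup V] [NormedSpace ℂ V] [CompleteSpace V]
    {e : ℂ → StrongDual ℂ V} {U : Set ℂ} (hU : IsOpen U)
    (h : ∀ f, DifferentiableOn ℂ (fun t => e t f) U) {c : ℂ} (hc : c ∈ U) : ContinuousAt e c := by
  obtain ⟨R, hR, hRU⟩ := Metric.nhds_basis_closedBall.mem_iff.1 (hU.mem_nhds hc)
  obtain ⟨C, hC⟩ := banach_steinhaus (g := fun t : Metric.closedBall c R => e t) (by
    intro f
    obtain ⟨C, hC⟩ := (isCompact_closedBall c R).exists_bound_of_continuousOn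
      ((h f).continuousOn.mono hRU)
    exact ⟨C, fun i => hC i i.2⟩)
  have key : ∀ t ∈ Metric.ball c R, dist (e t) (e c) ≤ (2 * C / R) * dist t c := by
    intro t ht
    have hC0 : 0 ≤ C := (norm_nonneg _).trans (hC ⟨c, Metric.mem_closedBall_self hR.le⟩)
    rw [dist_eq_norm]
    refine ContinuousLinearMap.opNorm_le_bound _ (by positivity) fun f => ?_
    have := Complex.dist_le_div_mul_dist_of_mapsTo_ball (f := fun t => e t f) (c := c) (R₁ := R)
      (R₂ := 2 * C * ‖f‖) (z := t) ((h f).mono (Metric.ball_subset_closedBall.trans hRU)) (by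
        intro s hs
        rw [Metric.mem_closedBall, dist_eq_norm]
        have h1 := (e s).le_of_opNorm_le (hC ⟨s, Metric.ball_subset_closedBall hs⟩) f
        have h2 := (e c).le_of_opNorm_le (hC ⟨c, Metric.mem_closedBall_self hR.le⟩) f
        have := norm_sub_le (e s f) (e c f)
        linarith) ht
    rw [dist_eq_norm] at this
    rw [_root_.sub_apply]
    refine this.trans (le_of_eq ?_)
    ring
  rw [ContinuousAt, tendsto_iff_dist_tendsto_zero]
  refine squeeze_zero' (Filter.Eventually.of_forall fun _ => dist_nonneg)
    (Filter.eventually_of_mem (Metric.ball_mem_nhds c hR) key) ?_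
  have : Continuous fun t : ℂ => (2 * C / R) * dist t c := by fun_prop
  simpa using this.tendsto c

lemma weakstar_differentiableOn {V : Type*} [NormedAddCommGroup V] [NormedSpace ℂ V]
    [CompleteSpace V]
    {e : ℂ → StrongDual ℂ V} {U : Set ℂ} (hU : IsOpen U)
    (h : ∀ f, DifferentiableOn ℂ (fun t => e t f) U) : DifferentiableOn ℂ e U := by
  intro c hc
  obtain ⟨R, hR, hRU⟩ := Metric.nhds_basis_closedBall.mem_iff.1 (hU.mem_nhds hc)
  lift R to NNReal using hR.le
  have hcont : ContinuousOn e U := fun x hx => (weakstar_continuousAt hU h hx).continuousWithinAt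
  have hsph := hcont.mono (Metric.sphere_subset_closedBall.trans hRU)
  have hps := hasFPowerSeriesOn_cauchy_integral (f := e) (c := c) (R := R)
    (hsph.circleIntegrable R.coe_nonneg) (by exact_mod_cast hR)
  have hd := hps.analyticAt.differentiableAt
  refine (hd.congr_of_eventuallyEq ?_).differentiableWithinAt
  filter_upwards [Metric.ball_mem_nhds c hR] with w hw
  ext f
  have hne : ∀ z ∈ Metric.sphere c (R : ℝ), z - w ≠ 0 := by
    intro z hz h0
    rw [sub_eq_zero] at h0
    subst h0
    simp only [Metric.mem_sphere, Metric.mem_ball] at hz hw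
    linarith
  have hci : CircleIntegrable (fun z => (z - w)⁻¹ • e z) c R := by
    refine ContinuousOn.circleIntegrable R.coe_nonneg (ContinuousOn.fun_smul ?_ hsph)
    exact ContinuousOn.inv₀ (by fun_prop) hne
  have hd' : DiffContOnCl ℂ (fun t => e t f) (Metric.ball c R) :=
    (((h f).mono hRU).mono (Metric.closure_ball_subset_closedBall)).diffContOnCl
  have := hd'.two_pi_i_inv_smul_circleIntegral_sub_inv_smul hw
  rw [← this, _root_.smul_apply]
  congr 1
  have h3 := (ContinuousLinearMap.apply ℂ ℂ f).intervalIntegral_comp_comm hci.out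
  simp only [circleIntegral]
  rw [← ContinuousLinearMap.apply_apply (𝕜 := ℂ) f (∫ _ in _.._, _), ← h3]
  simp

/-- joint holomorphy of pairing -/
lemma pairing_diff {V : Type*} [NormedAddCommGroup V] [NormedSpace ℂ V] [CompleteSpace V]
    {e : ℂ → StrongDual ℂ V} {C : ℂ → V} {U W : Set ℂ} (hU : IsOpen U) (hW : IsOpen W)
    (he : ∀ f, DifferentiableOn ℂ (fun t => e t f) U)
    (hC : ∀ l : StrongDual ℂ V, DifferentiableOn ℂ (fun t => l (C t)) W) :
    DifferentiableOn ℂ (fun p : ℂ × ℂ => e p.1 (C p.2)) (U ×ˢ W) := by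
  have h1 := weakstar_differentiableOn hU he
  have h2 := weakstar_differentiableOn (e := fun t => NormedSpace.inclusionInDoubleDual ℂ V (C t))
    hW (by simpa using hC)
  have h1' : DifferentiableOn ℂ (fun p : ℂ × ℂ => e p.1) (U ×ˢ W) :=
    h1.comp differentiableOn_fst (fun p hp => hp.1)
  have h2' : DifferentiableOn ℂ (fun p : ℂ × ℂ => NormedSpace.inclusionInDoubleDual ℂ V (C p.2))
      (U ×ˢ W) :=
    h2.comp differentiableOn_snd (fun p hp => hp.2)
  simpa using h2'.clm_apply h1'

/-- A holomorphic function on a convex open set vanishing at the small real points. -/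
lemma real_vanish {g : ℂ → ℂ} {r : ℝ} (hr : 0 < r) (hg : DifferentiableOn ℂ g (Metric.ball 0 r))
    (h0 : ∀ x : ℝ, |x| < r → g x = 0) : ∀ z ∈ Metric.ball (0 : ℂ) r, g z = 0 := by
  have := (hg.analyticOnNhd Metric.isOpen_ball).eqOn_zero_of_preconnected_of_frequently_eq_zero
    (convex_ball (0 : ℂ) r).isPreconnected (Metric.mem_ball_self hr) ?_
  · exact this
  · have ht : Filter.Tendsto (fun x : ℝ => (x : ℂ)) (nhdsWithin 0 {0}ᶜ)
        (nhdsWithin (0 : ℂ) {0}ᶜ) := by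
      refine tendsto_nhdsWithin_iff.2 ⟨?_, ?_⟩
      · exact (Complex.continuous_ofReal.tendsto' 0 0 (by simp)).mono_left nhdsWithin_le_nhds
      · filter_upwards [self_mem_nhdsWithin] with x hx
        simpa using hx
    refine ht.frequently (Filter.Eventually.frequently ?_)
    filter_upwards [nhdsWithin_le_nhds (Metric.ball_mem_nhds (0 : ℝ) hr)] with x hx
    exact h0 x (by simpa using hx)

lemma polar_one {m : ℂ × ℂ → ℂ} {U : Set ℂ} (hU : IsOpen U) (hUc : IsPreconnected U)
    (hm : DifferentiableOn ℂ m ((starRingEnd ℂ ⁻¹' U) ×ˢ U))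
    (h0 : ∀ t ∈ U, m (starRingEnd ℂ t, t) = 0) :
    ∀ s t, starRingEnd ℂ s ∈ U → t ∈ U → m (s, t) = 0 := by
  intro s₁ t₁ hs₁ ht₁
  obtain ⟨r, hr, hrU⟩ := Metric.nhds_basis_ball.mem_iff.1 (hU.mem_nhds ht₁)
  have hc : ∀ z : ℂ, ‖starRingEnd ℂ z‖ = ‖z‖ := fun z => by simp
  have hI : ∀ z : ℂ, ‖Complex.I * z‖ = ‖z‖ := fun z => by simp
  have hmem1 : ∀ p q : ℂ, ‖p‖ < r / 2 → ‖q‖ < r / 2 → t₁ + p + Complex.I * q ∈ U := by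
    intro p q hp hq
    apply hrU
    rw [Metric.mem_ball, dist_eq_norm]
    have := norm_add_le p (Complex.I * q)
    rw [hI] at this
    rw [show t₁ + p + Complex.I * q - t₁ = p + Complex.I * q by ring]
    linarith
  have hmem2 : ∀ p q : ℂ, ‖p‖ < r / 2 → ‖q‖ < r / 2 →
      starRingEnd ℂ t₁ + p - Complex.I * q ∈ starRingEnd ℂ ⁻¹' U := by
    intro p q hp hq
    have := hmem1 (starRingEnd ℂ p) (starRingEnd ℂ q) (by rwa [hc]) (by rwa [hc])
    simpa using this
  have hG1 : ∀ q : ℝ, |q| < r / 2 → ∀ p ∈ Metric.ball (0 : ℂ) (r / 2),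
      m (starRingEnd ℂ t₁ + p - Complex.I * q, t₁ + p + Complex.I * q) = 0 := by
    intro q hq
    apply real_vanish (by positivity)
    · refine hm.comp (f := fun p : ℂ => (starRingEnd ℂ t₁ + p - Complex.I * q,
        t₁ + p + Complex.I * q)) (by fun_prop) ?_
      intro p hp
      have hp' : ‖p‖ < r / 2 := by simpa using hp
      have hq' : ‖(q : ℂ)‖ < r / 2 := by simpa using hq
      exact ⟨hmem2 p q hp' hq', hmem1 p q hp' hq'⟩
    · intro p hp
      have hp' : ‖(p : ℂ)‖ < r / 2 := by simpa using hp
      have hq' : ‖(q : ℂ)‖ < r / 2 := by simpa using hq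
      have := h0 _ (hmem1 p q hp' hq')
      simpa [sub_eq_add_neg] using this
  have hG2 : ∀ p ∈ Metric.ball (0 : ℂ) (r / 2), ∀ q ∈ Metric.ball (0 : ℂ) (r / 2),
      m (starRingEnd ℂ t₁ + p - Complex.I * q, t₁ + p + Complex.I * q) = 0 := by
    intro p hp
    apply real_vanish (by positivity)
    · refine hm.comp (f := fun q : ℂ => (starRingEnd ℂ t₁ + p - Complex.I * q,
        t₁ + p + Complex.I * q)) (by fun_prop) ?_
      intro q hq
      have hp' : ‖p‖ < r / 2 := by simpa using hp
      have hq' : ‖q‖ < r / 2 := by simpa using hq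
      exact ⟨hmem2 p q hp' hq', hmem1 p q hp' hq'⟩
    · intro q hq
      exact hG1 q hq p hp
  -- at fixed `t = t₁`
  have hUs : IsOpen (starRingEnd ℂ ⁻¹' U) := hU.preimage Complex.continuous_conj
  have hUsc : IsPreconnected (starRingEnd ℂ ⁻¹' U) := by
    have := hUc.image (starRingEnd ℂ) Complex.continuous_conj.continuousOn
    convert this using 1
    ext z
    constructor
    · intro hz
      exact ⟨_, hz, by simp⟩
    · rintro ⟨w, hw, rfl⟩
      simpa using hw
  have hd : DifferentiableOn ℂ (fun s => m (s, t₁)) (starRingEnd ℂ ⁻¹' U) :=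
    hm.comp (f := fun s : ℂ => (s, t₁)) (by fun_prop) (fun s hs => ⟨hs, ht₁⟩)
  refine (hd.analyticOnNhd hUs).eqOn_zero_of_preconnected_of_eventuallyEq_zero hUsc
    (z₀ := starRingEnd ℂ t₁) (by simpa using ht₁) ?_ hs₁
  filter_upwards [Metric.ball_mem_nhds (starRingEnd ℂ t₁) hr] with s hs
  rw [Metric.mem_ball, dist_eq_norm] at hs
  have := hG2 ((s - starRingEnd ℂ t₁) / 2) ?_ (Complex.I * ((s - starRingEnd ℂ t₁) / 2)) ?_
  · rw [Pi.zero_apply]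
    convert this using 2
    ext
    · simp only [← mul_assoc, Complex.I_mul_I]; ring
    · simp only [← mul_assoc, Complex.I_mul_I]; ring
  · simp; linarith
  · simp; linarith

/-- multi-dimensional identity theorem -/
lemma identity_md {E : Type*} [NormedAddCommGroup E] [NormedSpace ℂ E] {D : Set E}
    (hD : IsOpen D) (hDc : IsPreconnected D) {f : E → ℂ} (hf : DifferentiableOn ℂ f D)
    {a : E} (ha : a ∈ D) (h0 : ∀ᶠ x in nhds a, f x = 0) : ∀ x ∈ D, f x = 0 := by
  let Z : Set E := {x | ∀ᶠ y in nhds x, f y = 0}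
  have hZo : IsOpen Z := isOpen_setOfPred_eventually_nhds
  have hsub : D ⊆ Z := by
    refine hDc.subset_of_closure_inter_subset hZo ⟨a, ha, h0⟩ ?_
    rintro c ⟨hcl, hcD⟩
    obtain ⟨r, hr, hrD⟩ := Metric.nhds_basis_ball.mem_iff.1 (hD.mem_nhds hcD)
    obtain ⟨p, hpZ, hpc⟩ := Metric.mem_closure_iff.1 hcl r hr
    have hpB : p ∈ Metric.ball c r := by rwa [Metric.mem_ball, dist_comm]
    filter_upwards [Metric.ball_mem_nhds c hr] with q hq
    let l : ℂ → E := fun t => p + t • (q - p)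
    have hlc : Continuous l := by fun_prop
    have hld : Differentiable ℂ l := by fun_prop
    have hconv : Convex ℝ (l ⁻¹' Metric.ball c r) := by
      intro s hs t ht α β hα hβ hαβ
      have := (convex_ball c r) hs ht hα hβ hαβ
      rw [Set.mem_preimage]
      convert this using 1
      simp only [l, smul_add, add_smul, smul_assoc]
      have : p = α • p + β • p := by rw [← add_smul, hαβ, one_smul]
      nth_rewrite 1 [this]
      abel
    have hg : DifferentiableOn ℂ (f ∘ l) (l ⁻¹' Metric.ball c r) :=
      (hf.mono hrD).comp hld.differentiableOn (fun t ht => ht)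
    have := (hg.analyticOnNhd (Metric.isOpen_ball.preimage hlc)
      ).eqOn_zero_of_preconnected_of_eventuallyEq_zero hconv.isPreconnected (z₀ := 0)
      (by simpa [l] using hpB)
      (by
        have : Filter.Tendsto l (nhds 0) (nhds p) := hlc.tendsto' _ _ (by simp [l])
        exact this.eventually hpZ)
      (show (1 : ℂ) ∈ _ by simpa [l] using hq)
    simpa [l] using this
  intro x hx
  exact (hsub hx).self_of_nhds

lemma conj_comp_hol {n : ℕ} {E' : Type*} [NormedAddCommGroup E'] [NormedSpace ℂ E']
    {D : Set (EuclideanSpace ℂ (Fin n))} (hD : IsOpen D)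
    {g : EuclideanSpace ℂ (Fin n) → ℂ} (hg : DifferentiableOn ℂ g D)
    {φ : E' → EuclideanSpace ℂ (Fin n)} {S : Set E'} (hφ : Set.MapsTo φ S D)
    (hφd : DifferentiableOn ℂ (fun x => conjE n (φ x)) S) :
    DifferentiableOn ℂ (fun x => starRingEnd ℂ (g (φ x))) S := by
  have hcc : ∀ z, conjE n (conjE n z) = z := by
    intro z; ext i; simp [conjE]
  let R0 : EuclideanSpace ℂ (Fin n) →ₛₗ[starRingEnd ℂ] EuclideanSpace ℂ (Fin n) :=
    { toFun := conjE n
      map_add' := by intro x y; ext i; simp [conjE]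
      map_smul' := by intro c x; ext i; simp [conjE] }
  let R : EuclideanSpace ℂ (Fin n) →SL[starRingEnd ℂ] EuclideanSpace ℂ (Fin n) :=
    ⟨R0, by
      change Continuous (conjE n)
      unfold conjE
      refine (PiLp.continuous_toLp 2 _).comp ?_
      refine continuous_pi fun i => Complex.continuous_conj.comp ?_
      fun_prop⟩
  let L0 : ℂ →ₛₗ[starRingEnd ℂ] ℂ :=
    { toFun := starRingEnd ℂ
      map_add' := by simp
      map_smul' := by simp }
  let L : ℂ →SL[starRingEnd ℂ] ℂ := ⟨L0, Complex.continuous_conj⟩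
  intro x hx
  have h1 : DifferentiableAt ℂ g (R (conjE n (φ x))) := by
    change DifferentiableAt ℂ g (conjE n (conjE n (φ x)))
    rw [hcc]
    exact hg.differentiableAt (hD.mem_nhds (hφ hx))
  have h2 : DifferentiableAt ℂ (L ∘ g ∘ R) (conjE n (φ x)) := h1.comp_semilinear₂ L R
  have h3 := h2.comp_differentiableWithinAt x (hφd x hx)
  refine h3.congr (fun y _ => ?_) ?_
  · change _ = starRingEnd ℂ (g (conjE n (conjE n (φ y))))
    rw [hcc]
  · change _ = starRingEnd ℂ (g (conjE n (conjE n (φ x))))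
    rw [hcc]

lemma conj_conj_on {g : ℂ → ℂ} {U : Set ℂ} (hU : IsOpen U) (hg : DifferentiableOn ℂ g U) :
    DifferentiableOn ℂ (fun s => starRingEnd ℂ (g (starRingEnd ℂ s))) (starRingEnd ℂ ⁻¹' U) := by
  intro s hs
  have := (hg.differentiableAt (hU.mem_nhds hs)).conj_conj
  rw [Complex.conj_conj] at this
  exact this.differentiableWithinAt

lemma kernel_sym {n : ℕ} {D : Set (EuclideanSpace ℂ (Fin n))}
    (hD : IsOpen D) (hDc : IsConnected D)
    {𝓥 : Type*} [NormedAddCommGroup 𝓥] [InnerProductSpace ℂ 𝓥] [CompleteSpace 𝓥]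
    {T : 𝓥 → (EuclideanSpace ℂ (Fin n) → ℂ)}
    (hT_hol : ∀ f : 𝓥, DifferentiableOn ℂ (T f) D)
    {k : EuclideanSpace ℂ (Fin n) → 𝓥} (hk : ∀ y ∈ D, ∀ f, T f y = ⟪k y, f⟫)
    {σ : EuclideanSpace ℂ (Fin n) → EuclideanSpace ℂ (Fin n)}
    (hσ : Set.MapsTo σ D D)
    (hσ_anti : DifferentiableOn ℂ (fun x => conjE n (σ x)) D)
    (hdiag : ∀ x ∈ D, ⟪k (σ x), k (σ x)⟫ = ⟪k x, k x⟫) :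
    ∀ x ∈ D, ∀ y ∈ D, ⟪k y, k x⟫ = ⟪k (σ x), k (σ y)⟫ := by
  have hTσ : ∀ f, DifferentiableOn ℂ (fun x => starRingEnd ℂ (T f (σ x))) D :=
    fun f => conj_comp_hol hD (hT_hol f) hσ hσ_anti
  obtain ⟨a, ha⟩ := hDc.nonempty
  obtain ⟨r, hr, hrD⟩ := Metric.nhds_basis_ball.mem_iff.1 (hD.mem_nhds ha)
  let L : EuclideanSpace ℂ (Fin n) → EuclideanSpace ℂ (Fin n) → ℂ :=
    fun x y => ⟪k y, k x⟫ - ⟪k (σ x), k (σ y)⟫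
  have hLsymm : ∀ x y, L y x = starRingEnd ℂ (L x y) := by
    intro x y
    simp only [L, map_sub, inner_conj_symm]
  have hLhol : ∀ x, DifferentiableOn ℂ (L x) D := by
    intro x
    refine ((hT_hol (k x)).sub (hTσ (k (σ x)))).congr fun y hy => ?_
    simp only [L, Pi.sub_apply, hk y hy, hk _ (hσ hy), inner_conj_symm]
  have hloc : ∀ x ∈ Metric.ball a r, ∀ y ∈ Metric.ball a r, L x y = 0 := by
    intro x hx y hy
    let l : ℂ → EuclideanSpace ℂ (Fin n) := fun t => x + t • (y - x)
    have hlc : Continuous l := by fun_prop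
    have hld : Differentiable ℂ l := by fun_prop
    have hconv : Convex ℝ (l ⁻¹' Metric.ball a r) := by
      intro s hs t ht α β hα hβ hαβ
      have := (convex_ball a r) hs ht hα hβ hαβ
      rw [Set.mem_preimage]
      convert this using 1
      simp only [l, smul_add, add_smul, smul_assoc]
      have : x = α • x + β • x := by rw [← add_smul, hαβ, one_smul]
      nth_rewrite 1 [this]
      abel
    set U := l ⁻¹' Metric.ball a r with hUdef
    have hU : IsOpen U := Metric.isOpen_ball.preimage hlc
    have hUs : IsOpen (starRingEnd ℂ ⁻¹' U) := hU.preimage Complex.continuous_conj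
    have hlD : ∀ t ∈ U, l t ∈ D := fun t ht => hrD ht
    have hA : ∀ f, DifferentiableOn ℂ (fun t => T f (l t)) U := fun f =>
      (hT_hol f).comp hld.differentiableOn hlD
    have hB : ∀ f, DifferentiableOn ℂ (fun t => starRingEnd ℂ (T f (σ (l t)))) U := fun f =>
      (hTσ f).comp hld.differentiableOn hlD
    have hm1 : DifferentiableOn ℂ (fun p : ℂ × ℂ =>
        innerSL ℂ (k (l p.1)) (k (l (starRingEnd ℂ p.2)))) (U ×ˢ (starRingEnd ℂ ⁻¹' U)) := by
      refine pairing_diff (e := fun t => innerSL ℂ (k (l t)))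
        (C := fun s => k (l (starRingEnd ℂ s))) hU hUs ?_ ?_
      · intro f
        refine (hA f).congr fun t ht => ?_
        rw [innerSL_apply_apply, hk _ (hlD t ht)]
      · intro φ
        refine (conj_conj_on hU (hA ((InnerProductSpace.toDual ℂ 𝓥).symm φ))).congr
          fun s hs => ?_
        rw [hk _ (hlD _ hs), inner_conj_symm, InnerProductSpace.toDual_symm_apply]
    have hm2 : DifferentiableOn ℂ (fun p : ℂ × ℂ =>
        innerSL ℂ (k (σ (l (starRingEnd ℂ p.1)))) (k (σ (l p.2))))
        ((starRingEnd ℂ ⁻¹' U) ×ˢ U) := by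
      refine pairing_diff (e := fun s => innerSL ℂ (k (σ (l (starRingEnd ℂ s)))))
        (C := fun t => k (σ (l t))) hUs hU ?_ ?_
      · intro f
        refine (conj_conj_on hU (hB f)).congr fun s hs => ?_
        rw [innerSL_apply_apply, Complex.conj_conj, hk _ (hσ (hlD _ hs))]
      · intro φ
        refine (hB ((InnerProductSpace.toDual ℂ 𝓥).symm φ)).congr fun t ht => ?_
        rw [hk _ (hσ (hlD _ ht)), inner_conj_symm, InnerProductSpace.toDual_symm_apply]
    have hm1' : DifferentiableOn ℂ (fun p : ℂ × ℂ =>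
        innerSL ℂ (k (l p.2)) (k (l (starRingEnd ℂ p.1)))) ((starRingEnd ℂ ⁻¹' U) ×ˢ U) :=
      hm1.comp (f := fun p : ℂ × ℂ => (p.2, p.1)) (by fun_prop) (fun p hp => ⟨hp.2, hp.1⟩)
    have := polar_one hU hconv.isPreconnected (hm1'.sub hm2) ?_ 0 1 ?_ ?_
    · simpa [l, L] using this
    · intro t ht
      simp only [Pi.sub_apply, innerSL_apply_apply, Complex.conj_conj]
      rw [hdiag _ (hlD t ht), sub_self]
    · simpa [hUdef, l] using hx
    · simpa [hUdef, l] using hy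
  have h2 : ∀ x ∈ Metric.ball a r, ∀ y ∈ D, L x y = 0 := fun x hx =>
    identity_md hD hDc.isPreconnected (hLhol x) ha
      (Filter.eventually_of_mem (Metric.ball_mem_nhds a hr) (hloc x hx))
  have h3 : ∀ x ∈ D, ∀ y ∈ D, L x y = 0 := fun x hx =>
    identity_md hD hDc.isPreconnected (hLhol x) ha
      (Filter.eventually_of_mem (Metric.ball_mem_nhds a hr) (fun y hy => by
        rw [hLsymm, h2 y hy x hx, map_zero]))
  intro x hx y hy
  exact sub_eq_zero.1 (h3 x hx y hy)

lemma exists_J {X : Type*} {D : Set X}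
    {𝓥 : Type*} [NormedAddCommGroup 𝓥] [InnerProductSpace ℂ 𝓥] [CompleteSpace 𝓥]
    {k : X → 𝓥} (hk : ∀ f : 𝓥, (∀ y ∈ D, ⟪k y, f⟫ = 0) → f = 0)
    {σ σinv : X → X} (hσinv : Set.MapsTo σinv D D)
    (hσ_right : ∀ x ∈ D, σ (σinv x) = x)
    (hsym : ∀ x ∈ D, ∀ y ∈ D, ⟪k y, k x⟫ = ⟪k (σ x), k (σ y)⟫) (f : 𝓥) :
    ∃ g : 𝓥, ‖g‖ = ‖f‖ ∧ ∀ x ∈ D, ⟪k x, g⟫ = ⟪f, k (σ x)⟫ := by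
  let Φ : (D →₀ ℂ) → 𝓥 := fun c => c.sum fun i a => a • k i
  let Ψ : (D →₀ ℂ) → 𝓥 := fun c => c.sum fun i a => starRingEnd ℂ a • k (σinv i)
  have hΦsub : ∀ c d, Φ (c - d) = Φ c - Φ d := fun c d =>
    Finsupp.sum_sub_index (fun i a b => sub_smul _ _ _)
  have hΨsub : ∀ c d, Ψ (c - d) = Ψ c - Ψ d := fun c d =>
    Finsupp.sum_sub_index (fun i a b => by rw [map_sub, sub_smul])
  have hpt : ∀ c, ∀ x ∈ D, ⟪k x, Ψ c⟫ = ⟪Φ c, k (σ x)⟫ := by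
    intro c x hx
    simp only [Φ, Ψ, Finsupp.sum, inner_sum, sum_inner, inner_smul_left, inner_smul_right]
    refine Finset.sum_congr rfl fun i _ => ?_
    rw [hsym _ (hσinv i.2) x hx, hσ_right _ i.2]
  have hnorm : ∀ c, ‖Ψ c‖ = ‖Φ c‖ := by
    intro c
    have h1 : ⟪Ψ c, Ψ c⟫ = ⟪Φ c, Φ c⟫ := by
      have e1 : ⟪Ψ c, Ψ c⟫ = c.sum fun i a => a * ⟪k (σinv i), Ψ c⟫ := by
        conv_lhs => simp only [Ψ]
        simp only [Finsupp.sum, sum_inner, inner_smul_left, Complex.conj_conj, Ψ]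
      have e2 : ⟪Φ c, Φ c⟫ = c.sum fun i a => a * ⟪Φ c, k i⟫ := by
        simp only [Finsupp.sum, inner_sum, inner_smul_right, Φ]
      rw [e1, e2]
      refine Finset.sum_congr rfl fun i _ => ?_
      simp only
      rw [hpt c _ (hσinv i.2), hσ_right _ i.2]
    rw [inner_self_eq_norm_sq_to_K, inner_self_eq_norm_sq_to_K] at h1
    have h2 : ‖Ψ c‖ ^ 2 = ‖Φ c‖ ^ 2 := by exact_mod_cast h1
    exact (pow_left_inj₀ (norm_nonneg _) (norm_nonneg _) two_ne_zero).1 h2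
  have hdense : (Submodule.span ℂ (Set.range fun i : D => k i)).topologicalClosure = ⊤ := by
    rw [Submodule.topologicalClosure_eq_top_iff, Submodule.eq_bot_iff]
    intro v hv
    refine hk v fun y hy => ?_
    exact (Submodule.mem_orthogonal _ _).1 hv _ (Submodule.subset_span ⟨⟨y, hy⟩, rfl⟩)
  have hf : f ∈ closure (Submodule.span ℂ (Set.range fun i : D => k i) : Set 𝓥) := by
    rw [← Submodule.topologicalClosure_coe, hdense]; trivial
  obtain ⟨u, hu, hlim⟩ := mem_closure_iff_seq_limit.1 hf
  have hu' : ∀ m, ∃ c : D →₀ ℂ, Φ c = u m := fun m =>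
    Finsupp.mem_span_range_iff_exists_finsupp.1 (hu m)
  choose c hc using hu'
  have hcau : CauchySeq fun m => Ψ (c m) := by
    have h1 := hlim.cauchySeq
    rw [Metric.cauchySeq_iff] at h1 ⊢
    intro ε hε
    obtain ⟨N, hN⟩ := h1 ε hε
    refine ⟨N, fun m hm p hp => ?_⟩
    have := hN m hm p hp
    rwa [dist_eq_norm, ← hΨsub, hnorm, hΦsub, hc, hc, ← dist_eq_norm]
  obtain ⟨g, hg⟩ := cauchySeq_tendsto_of_complete hcau
  refine ⟨g, ?_, fun x hx => ?_⟩
  · refine tendsto_nhds_unique hg.norm ?_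
    simp only [hnorm, hc]
    exact hlim.norm
  · refine tendsto_nhds_unique (tendsto_const_nhds.inner hg) ?_
    simp only [hpt _ x hx, hc]
    exact hlim.inner tendsto_const_nhds

/-- **Construction of the anti-linear isometry `J`.** Let `𝓥` be a Hilbert space of
holomorphic functions on a nonempty connected open `D ⊆ ℂⁿ` on which `H` acts unitarily
by translations, and let `σ` be an anti-holomorphic diffeomorphism of `D` preserving
every `H`-orbit.  Then `(Jf)(x) := conj (f (σ x))` defines a bijection `J : 𝓥 → 𝓥`
with `⟨Jf, Jg⟩ = ⟨g, f⟩`; in particular `J` is a conjugate-linear isometry of `𝓥` onto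
itself.  (Recall that Mathlib's inner product is conjugate-linear in the first argument,
so the paper's inner product `⟨f, g⟩`, linear in `f`, is `⟪g, f⟫` below.) -/
theorem antilinear_isometry_J
    {n : ℕ} (D : Set (EuclideanSpace ℂ (Fin n)))
    (hD_open : IsOpen D) (hD_conn : IsConnected D)
    {H : Type*} [Group H] [MulAction H (EuclideanSpace ℂ (Fin n))]
    (hact_maps : ∀ h : H, Set.MapsTo (fun x => h • x) D D)
    (hact_hol : ∀ h : H, DifferentiableOn ℂ (fun x => h • x) D)
    {𝓥 : Type*} [NormedAddCommGroup 𝓥] [InnerProductSpace ℂ 𝓥] [CompleteSpace 𝓥]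
    (T : 𝓥 →ₗ[ℂ] (EuclideanSpace ℂ (Fin n) → ℂ))
    (hT_inj : ∀ f g : 𝓥, (∀ x ∈ D, T f x = T g x) → f = g)
    (hT_hol : ∀ f : 𝓥, DifferentiableOn ℂ (T f) D)
    (hT_eval : ∀ y ∈ D, Continuous fun f : 𝓥 => T f y)
    (τ : H → 𝓥 →ₗ[ℂ] 𝓥)
    (hτ_eval : ∀ (h : H) (f : 𝓥), ∀ x ∈ D, T (τ h f) x = T f (h⁻¹ • x))
    (hτ_unitary : ∀ (h : H) (f g : 𝓥), ⟪τ h f, τ h g⟫ = ⟪f, g⟫)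
    (hτ_surj : ∀ h : H, Function.Surjective (τ h))
    (σ σinv : EuclideanSpace ℂ (Fin n) → EuclideanSpace ℂ (Fin n))
    (hσ_maps : Set.MapsTo σ D D) (hσinv_maps : Set.MapsTo σinv D D)
    (hσ_left : ∀ x ∈ D, σinv (σ x) = x) (hσ_right : ∀ x ∈ D, σ (σinv x) = x)
    (hσ_anti : DifferentiableOn ℂ (fun x => conjE n (σ x)) D)
    (hσinv_anti : DifferentiableOn ℂ (fun x => conjE n (σinv x)) D)
    (hσ_orbit : ∀ x ∈ D, ∃ h : H, σ x = h • x) :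
    ∃ J : 𝓥 → 𝓥,
      (∀ f : 𝓥, ∀ x ∈ D, T (J f) x = (starRingEnd ℂ) (T f (σ x))) ∧
      Function.Bijective J ∧
      (∀ f g : 𝓥, J (f + g) = J f + J g) ∧
      (∀ (c : ℂ) (f : 𝓥), J (c • f) = (starRingEnd ℂ) c • J f) ∧
      (∀ f g : 𝓥, ⟪J f, J g⟫ = ⟪g, f⟫) ∧
      (∀ f : 𝓥, ‖J f‖ = ‖f‖) := by
  let ev : EuclideanSpace ℂ (Fin n) → StrongDual ℂ 𝓥 := fun y =>
    open Classical in
    if hy : y ∈ D then ⟨(LinearMap.proj y).comp T, hT_eval y hy⟩ else 0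
  let k : EuclideanSpace ℂ (Fin n) → 𝓥 := fun y => (InnerProductSpace.toDual ℂ 𝓥).symm (ev y)
  have hk : ∀ y ∈ D, ∀ f, T f y = ⟪k y, f⟫ := by
    intro y hy f
    simp only [k, InnerProductSpace.toDual_symm_apply, ev, dif_pos hy]
    rfl
  have hτk : ∀ (h : H), ∀ x ∈ D, k (h • x) = τ h (k x) := by
    intro h x hx
    refine ext_inner_right ℂ fun v => ?_
    obtain ⟨g, rfl⟩ := hτ_surj h v
    rw [hτ_unitary, ← hk _ (hact_maps h hx), hτ_eval h g _ (hact_maps h hx), inv_smul_smul,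
      hk x hx]
  have hdiag : ∀ x ∈ D, ⟪k (σ x), k (σ x)⟫ = ⟪k x, k x⟫ := by
    intro x hx
    obtain ⟨h, hh⟩ := hσ_orbit x hx
    rw [hh, hτk h x hx, hτ_unitary]
  have hsym := kernel_sym hD_open hD_conn hT_hol hk hσ_maps hσ_anti hdiag
  have hsym' : ∀ x ∈ D, ∀ y ∈ D, ⟪k y, k x⟫ = ⟪k (σinv x), k (σinv y)⟫ := by
    intro x hx y hy
    rw [hsym _ (hσinv_maps hy) _ (hσinv_maps hx), hσ_right x hx, hσ_right y hy]
  have hk0 : ∀ f : 𝓥, (∀ y ∈ D, ⟪k y, f⟫ = 0) → f = 0 := by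
    intro f hf
    refine hT_inj f 0 fun x hx => ?_
    rw [hk x hx, hf x hx, map_zero, Pi.zero_apply]
  choose J hJn hJ using exists_J hk0 hσinv_maps hσ_right hsym
  have hJT : ∀ f : 𝓥, ∀ x ∈ D, T (J f) x = (starRingEnd ℂ) (T f (σ x)) := by
    intro f x hx
    rw [hk x hx, hJ f x hx, hk _ (hσ_maps hx), inner_conj_symm]
  have hadd : ∀ f g : 𝓥, J (f + g) = J f + J g := by
    intro f g
    refine hT_inj _ _ fun x hx => ?_
    simp [hJT _ x hx]
  have hsmul : ∀ (c : ℂ) (f : 𝓥), J (c • f) = (starRingEnd ℂ) c • J f := by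
    intro c f
    refine hT_inj _ _ fun x hx => ?_
    simp [hJT _ x hx]
  have hsub : ∀ f g : 𝓥, J (f - g) = J f - J g := by
    intro f g
    refine hT_inj _ _ fun x hx => ?_
    simp [hJT _ x hx]
  refine ⟨J, hJT, ⟨?_, ?_⟩, hadd, hsmul, ?_, hJn⟩
  · intro f g hfg
    rw [← sub_eq_zero, ← norm_eq_zero, ← hJn, hsub, hfg, sub_self, norm_zero]
  · intro f
    obtain ⟨g, -, hg⟩ := exists_J hk0 hσ_maps hσ_left hsym' f
    refine ⟨g, hT_inj _ _ fun x hx => ?_⟩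
    rw [hJT g x hx, hk _ (hσ_maps hx), hg _ (hσ_maps hx), hσ_left x hx, inner_conj_symm, hk x hx]
  · intro f g
    have hI : ∀ v, J (Complex.I • v) = - (Complex.I • J v) := by
      intro v
      rw [hsmul, Complex.conj_I, neg_smul]
    have e1 : ‖J f + Complex.I • J g‖ = ‖f - Complex.I • g‖ := by
      rw [← hJn (f - Complex.I • g), hsub, hI, sub_neg_eq_add]
    have e2 : ‖J f - Complex.I • J g‖ = ‖f + Complex.I • g‖ := by
      rw [← hJn (f + Complex.I • g), hadd, hI, sub_eq_add_neg]
    have e3 : ‖J f + J g‖ = ‖f + g‖ := by rw [← hadd, hJn]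
    have e4 : ‖J f - J g‖ = ‖f - g‖ := by rw [← hsub, hJn]
    rw [← inner_conj_symm g f, inner_eq_sum_norm_sq_div_four (𝕜 := ℂ) (J f) (J g),
      inner_eq_sum_norm_sq_div_four (𝕜 := ℂ) f g]
    simp only [RCLike.I_to_complex, e1, e2, e3, e4]
    have h4 : (starRingEnd ℂ) (4 : ℂ) = 4 := Complex.conj_ofNat 4
    simp [Complex.conj_ofReal, h4]
    ring
end

section
/- Let D be a nonempty connected open subset of ℂ^n and H a group acting on D such that for each h ∈ H the map x ↦ h·x is a biholomorphic bijection of D. Let 𝓥 be a Hilbert space of holomorphic functions on D on which H acts unitarily by translations (τ_h f)(x) = f(h⁻¹·x). Let σ : D → D be a bijection such that σ and σ⁻¹ are anti-holomorphic and such that for every x ∈ D there exists h ∈ H with σ(x) = h·x, and define (Jf)(x) := conj(f(σ(x))). Then J maps 𝓥 bijectively onto 𝓥, and for every continuous ℂ-linear map A : 𝓥 → 𝓥 commuting with τ_h for all h ∈ H, the Hilbert-space adjoint of A satisfies A* = J ∘ A ∘ J⁻¹. -/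
open scoped ComplexInnerProductSpace

open Filter Topology

lemma weak_cont {W : Type*} [NormedAddCommGroup W] [NormedSpace ℂ W] [CompleteSpace W]
    {Ω : Set ℂ} (hΩ : IsOpen Ω) (g : ℂ → (W →L[ℂ] ℂ))
    (hg : ∀ w, DifferentiableOn ℂ (fun z => g z w) Ω) {c : ℂ} (hc : c ∈ Ω) :
    ContinuousAt g c := by
  obtain ⟨r, hr, hrΩ⟩ := Metric.nhds_basis_closedBall.mem_iff.1 (hΩ.mem_nhds hc)
  obtain ⟨C, hC⟩ : ∃ C, ∀ i : Metric.closedBall c r, ‖g i‖ ≤ C := by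
    apply banach_steinhaus
    intro w
    obtain ⟨C, hC⟩ := (isCompact_closedBall c r).exists_bound_of_continuousOn
      ((hg w).continuousOn.mono hrΩ)
    exact ⟨C, fun i => hC i i.2⟩
  have hCnn : 0 ≤ C := (norm_nonneg _).trans (hC ⟨c, Metric.mem_closedBall_self hr.le⟩)
  have key : ∀ z ∈ Metric.ball c r, ‖g z - g c‖ ≤ 2 * C / r * dist z c := by
    intro z hz
    apply ContinuousLinearMap.opNorm_le_bound _ (by positivity)
    intro w
    have h := Complex.dist_le_div_mul_dist_of_mapsTo_ball (R₂ := 2 * C * ‖w‖)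
      ((hg w).mono (Metric.ball_subset_closedBall.trans hrΩ)) (fun y hy => by
        have h1 := (g y).le_of_opNorm_le (hC ⟨y, Metric.ball_subset_closedBall hy⟩) w
        have h2 := (g c).le_of_opNorm_le (hC ⟨c, Metric.mem_closedBall_self hr.le⟩) w
        rw [mem_closedBall_iff_norm]
        have := norm_sub_le (g y w) (g c w)
        linarith) hz
    rw [dist_eq_norm (g z w)] at h
    calc _ = ‖g z w - g c w‖ := by simp
      _ ≤ _ := h
      _ = _ := by ring
  rw [ContinuousAt, tendsto_iff_norm_sub_tendsto_zero]
  refine squeeze_zero' (.of_forall fun _ => norm_nonneg _)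
    (Filter.eventually_of_mem (Metric.ball_mem_nhds c hr) key) ?_
  have : Tendsto (fun z => 2 * C / r * dist z c) (𝓝 c) (𝓝 (2 * C / r * dist c c)) := by
    apply Continuous.tendsto; fun_prop
  simpa using this

lemma weak_diff {W : Type*} [NormedAddCommGroup W] [NormedSpace ℂ W] [CompleteSpace W]
    {Ω : Set ℂ} (hΩ : IsOpen Ω) (g : ℂ → (W →L[ℂ] ℂ))
    (hg : ∀ w, DifferentiableOn ℂ (fun z => g z w) Ω) {c : ℂ} (hc : c ∈ Ω) :
    DifferentiableAt ℂ g c := by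
  have hs : ∀ w, Tendsto (slope (fun z => g z w) c) (𝓝[≠] c) (𝓝 (deriv (fun z => g z w) c)) :=
    fun w => hasDerivAt_iff_tendsto_slope.1
      ((hg w).differentiableAt (hΩ.mem_nhds hc)).hasDerivAt
  have hsl : ∀ z w, slope g c z w = slope (fun z => g z w) c z := by
    intro z w; simp [slope]
  let L : W →L[ℂ] ℂ := continuousLinearMapOfTendsto (l := 𝓝[≠] c) (slope g c)
    (f := fun w => deriv (fun z => g z w) c) (by
      rw [tendsto_pi_nhds]
      intro w
      simpa only [hsl] using hs w)
  have hL : ∀ w, L w = deriv (fun z => g z w) c := fun w => rfl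
  let G : ℂ → (W →L[ℂ] ℂ) := Function.update (slope g c) c L
  have hG : ContinuousAt G c := by
    apply weak_cont hΩ _ _ hc
    intro w
    have : (fun z => G z w) = dslope (fun z => g z w) c := by
      funext z
      by_cases hz : z = c
      · subst hz; simp [G, hL]
      · simp [G, hz, dslope_of_ne, hsl]
    rw [this]
    exact (Complex.differentiableOn_dslope (hΩ.mem_nhds hc)).2 (hg w)
  have := continuousAt_update_same.1 hG
  exact (hasDerivAt_iff_tendsto_slope.2 this).differentiableAt

lemma pair_diff {V : Type*} [NormedAddCommGroup V] [InnerProductSpace ℂ V] [CompleteSpace V]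
    {Ω : Set ℂ} (hΩ : IsOpen Ω) (a b : ℂ → V)
    (ha : ∀ f, DifferentiableOn ℂ (fun z => ⟪a z, f⟫) Ω)
    (hb : ∀ f, DifferentiableOn ℂ (fun z => ⟪f, b z⟫) Ω) (A : V →L[ℂ] V) {c : ℂ} (hc : c ∈ Ω) :
    DifferentiableAt ℂ (fun z => ⟪a z, A (b z)⟫) c := by
  have h1 : DifferentiableAt ℂ (fun z => innerSL ℂ (a z)) c :=
    weak_diff hΩ _ (by simpa using ha) hc
  have h2 : DifferentiableAt ℂ (fun z => NormedSpace.inclusionInDoubleDual ℂ V (b z)) c := by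
    apply weak_diff hΩ _ _ hc
    intro φ
    have : ∀ z, φ (b z) = ⟪(InnerProductSpace.toDual ℂ V).symm φ, b z⟫ := by simp
    simp only [NormedSpace.dual_def, this]
    exact hb _
  have h3 : DifferentiableAt ℂ (fun z => (innerSL ℂ (a z)).comp A) c := by fun_prop
  have := h2.clm_apply h3
  simpa using this

lemma real_zero {g : ℂ → ℂ} (hg : DifferentiableOn ℂ g (Metric.ball 0 1))
    (h0 : ∀ t : ℝ, |t| < 1 → g t = 0) : ∀ z ∈ Metric.ball (0 : ℂ) 1, g z = 0 := by
  refine (hg.analyticOnNhd Metric.isOpen_ball).eqOn_zero_of_preconnected_of_frequently_eq_zero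
    (convex_ball _ _).isPreconnected (z₀ := 0) (by simp) ?_
  have ht : Tendsto (fun t : ℝ => (t : ℂ)) (𝓝[≠] 0) (𝓝[≠] 0) := by
    apply tendsto_nhdsWithin_of_tendsto_nhds_of_eventually_within
    · exact (Complex.continuous_ofReal.tendsto' 0 0 (by simp)).mono_left nhdsWithin_le_nhds
    · filter_upwards [self_mem_nhdsWithin] with t ht
      simpa using ht
  apply ht.frequently
  apply Eventually.frequently
  have : ∀ᶠ t : ℝ in 𝓝[≠] 0, t ∈ Metric.ball (0:ℝ) 1 :=
    nhdsWithin_le_nhds (Metric.ball_mem_nhds _ one_pos)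
  filter_upwards [this] with t ht
  apply h0
  simpa using ht

lemma ident {E : Type*} [NormedAddCommGroup E] [NormedSpace ℂ E] {D : Set E} (hD : IsOpen D)
    (hc : IsPreconnected D) {f : E → ℂ} (hf : DifferentiableOn ℂ f D) {z : E} (hz : z ∈ D)
    (h0 : ∀ᶠ x in 𝓝 z, f x = 0) : ∀ x ∈ D, f x = 0 := by
  have : D ⊆ {x | ∀ᶠ y in 𝓝 x, f y = 0} := by
    apply hc.subset_of_closure_inter_subset isOpen_setOfPred_eventually_nhds ⟨z, hz, h0⟩
    rintro x ⟨hx, hxD⟩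
    obtain ⟨r, hr, hrD⟩ := Metric.isOpen_iff.1 hD x hxD
    obtain ⟨y, hyr, hy⟩ := (mem_closure_iff_nhds.1 hx _ (Metric.ball_mem_nhds x hr))
    refine Filter.eventually_of_mem (Metric.ball_mem_nhds x hr) fun w hw => ?_
    have hcont : Continuous (fun s : ℂ => y + s • (w - y)) := by fun_prop
    have hdiff : Differentiable ℂ (fun s : ℂ => y + s • (w - y)) := by fun_prop
    let U : Set ℂ := (fun s : ℂ => y + s • (w - y)) ⁻¹' Metric.ball x r
    have hU : IsOpen U := Metric.isOpen_ball.preimage hcont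
    have hconv : Convex ℝ U := by
      intro s hs t ht a b ha hb hab
      have := (convex_ball x r) hs ht ha hb hab
      simp only [U, Set.mem_preimage] at this ⊢
      convert this using 1
      have h1 : (a : ℂ) + b = 1 := by exact_mod_cast hab
      have h2 : y = (a : ℂ) • y + (b : ℂ) • y := by rw [← add_smul, h1, one_smul]
      rw [← Complex.coe_smul, ← Complex.coe_smul, ← Complex.coe_smul, ← Complex.coe_smul]
      nth_rewrite 1 [h2]
      simp only [smul_add, add_smul, smul_smul, smul_eq_mul]
      abel
    have han : AnalyticOnNhd ℂ (fun s : ℂ => f (y + s • (w - y))) U :=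
      DifferentiableOn.analyticOnNhd (hf.comp hdiff.differentiableOn fun s hs => hrD hs) hU
    have h0U : (0 : ℂ) ∈ U := by simpa [U] using hyr
    have := han.eqOn_of_preconnected_of_eventuallyEq (analyticOnNhd_const (v := 0)) hconv.isPreconnected h0U
      ((hcont.tendsto' 0 y (by simp)).eventually hy)
    have := this (x := 1) (by simpa [U] using hw)
    simpa using this
  exact fun x hx => (this hx).self_of_nhds

lemma sesqui {E : Type*} [NormedAddCommGroup E] [NormedSpace ℂ E] {D : Set E} (hD : IsOpen D)
    (hc : IsConnected D) (F : E → E → ℂ)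
    (hx : ∀ y ∈ D, DifferentiableOn ℂ (fun x => F x y) D)
    (hy : ∀ x ∈ D, DifferentiableOn ℂ (fun y => (starRingEnd ℂ) (F x y)) D)
    (hs : ∀ x y u : E, ∀ s : ℂ, x + s • u ∈ D → y + (starRingEnd ℂ s) • u ∈ D →
      DifferentiableAt ℂ (fun s : ℂ => F (x + s • u) (y + (starRingEnd ℂ s) • u)) s)
    (h0 : ∀ x ∈ D, F x x = 0) : ∀ x ∈ D, ∀ y ∈ D, F x y = 0 := by
  obtain ⟨z, hz⟩ := hc.nonempty
  obtain ⟨r, hr, hrD⟩ := Metric.isOpen_iff.1 hD z hz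
  have loc : ∀ p q : E, ‖p‖ < r / 4 → ‖q‖ < r / 4 → F (z + p) (z + q) = 0 := by
    intro p q hp hq
    set u := p + q with hu
    set w := Complex.I • (p - q) with hw
    have hun : ‖u‖ < r / 2 := (norm_add_le _ _).trans_lt (by linarith)
    have hwn : ‖w‖ < r / 2 := by
      rw [hw, norm_smul, Complex.norm_I, one_mul]
      exact (norm_sub_le _ _).trans_lt (by linarith)
    have hmem : ∀ α β : ℂ, ‖α‖ < 1 → ‖β‖ < 1 → z + α • u + β • w ∈ D := by
      intro α β hα hβ
      apply hrD
      rw [mem_ball_iff_norm, add_assoc, add_sub_cancel_left]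
      calc _ ≤ ‖α‖ * ‖u‖ + ‖β‖ * ‖w‖ := by
            simpa [norm_smul] using norm_add_le (α • u) (β • w)
        _ ≤ 1 * ‖u‖ + 1 * ‖w‖ := by gcongr
        _ < r := by linarith
    let c := starRingEnd ℂ
    have hcn : ∀ s : ℂ, ‖c s‖ = ‖s‖ := fun s => by simp [c]
    have s1 : ∀ β : ℝ, |β| < 1 → ∀ α ∈ Metric.ball (0 : ℂ) 1,
        F (z + (β : ℂ) • w + α • u) (z + (β : ℂ) • w + c α • u) = 0 := by
      intro β hβ
      have hβ' : ‖(β : ℂ)‖ < 1 := by simpa using hβ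
      apply real_zero (g := fun α => F (z + (β : ℂ) • w + α • u) (z + (β : ℂ) • w + c α • u))
      · intro α hα
        rw [mem_ball_zero_iff] at hα
        apply DifferentiableAt.differentiableWithinAt
        apply hs
        · rw [add_right_comm]; exact hmem _ _ hα hβ'
        · rw [add_right_comm]; exact hmem _ _ ((hcn _).trans_lt hα) hβ'
      · intro t ht
        simp only [c, Complex.conj_ofReal]
        apply h0
        rw [add_right_comm]; exact hmem _ _ (by simpa using ht) hβ'
    have s2 : ∀ α : ℂ, ‖α‖ < 1 → ∀ β ∈ Metric.ball (0 : ℂ) 1,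
        F (z + α • u + β • w) (z + c α • u + c β • w) = 0 := by
      intro α hα
      apply real_zero (g := fun β => F (z + α • u + β • w) (z + c α • u + c β • w))
      · intro β hβ
        rw [mem_ball_zero_iff] at hβ
        apply DifferentiableAt.differentiableWithinAt
        apply hs
        · exact hmem _ _ hα hβ
        · exact hmem _ _ ((hcn _).trans_lt hα) ((hcn _).trans_lt hβ)
      · intro t ht
        have := s1 t ht α (by simpa using hα)
        simp only [c, Complex.conj_ofReal] at this ⊢
        rwa [add_right_comm z (α • u), add_right_comm z ((starRingEnd ℂ) α • u)]
    have := s2 (1 / 2) (by norm_num) (-Complex.I / 2) (by simp; norm_num)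
    have e1 : z + (1 / 2 : ℂ) • u + (-Complex.I / 2) • w = z + p := by
      rw [hu, hw, smul_smul]
      have : -Complex.I / 2 * Complex.I = 1 / 2 := by
        rw [div_mul_eq_mul_div, neg_mul, Complex.I_mul_I]; norm_num
      rw [this]
      module
    have e2 : z + c (1 / 2 : ℂ) • u + c (-Complex.I / 2) • w = z + q := by
      have h1 : c (1 / 2 : ℂ) = 1 / 2 := by
        simp only [c, map_div₀, map_one, Complex.conj_ofNat]
      have h2 : c (-Complex.I / 2) = Complex.I / 2 := by
        simp only [c, map_div₀, map_neg, Complex.conj_I, neg_neg, Complex.conj_ofNat]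
      rw [hu, hw, smul_smul, h1, h2]
      have : Complex.I / 2 * Complex.I = -1 / 2 := by
        rw [div_mul_eq_mul_div, Complex.I_mul_I]
      rw [this]
      module
    rwa [e1, e2] at this
  have locB : ∀ x ∈ Metric.ball z (r / 4), ∀ y ∈ Metric.ball z (r / 4), F x y = 0 := by
    intro x hx y hy
    have := loc (x - z) (y - z) (mem_ball_iff_norm.1 hx) (mem_ball_iff_norm.1 hy)
    simpa using this
  have hB : Metric.ball z (r / 4) ∈ 𝓝 z := Metric.ball_mem_nhds _ (by positivity)
  have hBD : Metric.ball z (r / 4) ⊆ D :=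
    (Metric.ball_subset_ball (by linarith)).trans hrD
  have st : ∀ y ∈ Metric.ball z (r / 4), ∀ x ∈ D, F x y = 0 := fun y hyB =>
    ident hD hc.isPreconnected (hx y (hBD hyB)) hz
      (Filter.eventually_of_mem hB fun x hxB => locB x hxB y hyB)
  intro x hxD y hyD
  have := ident hD hc.isPreconnected (hy x hxD) hz
      (Filter.eventually_of_mem hB fun y hyB => by rw [st y hyB x hxD, map_zero]) y hyD
  simpa using this

lemma antiunitary {V ι : Type*} [NormedAddCommGroup V] [InnerProductSpace ℂ V] [CompleteSpace V]
    (p q : ι → V) (hpq : ∀ i j, ⟪q i, q j⟫ = ⟪p j, p i⟫)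
    (hd : ∀ v, (∀ i, ⟪p i, v⟫ = 0) → v = 0) :
    (Dense (Submodule.span ℂ (Set.range p) : Set V)) ∧
    ∃ J : V →SL[starRingEnd ℂ] V, ∀ i, J (p i) = q i := by
  have hdense : Dense (Submodule.span ℂ (Set.range p) : Set V) := by
    rw [Submodule.dense_iff_topologicalClosure_eq_top, Submodule.topologicalClosure_eq_top_iff,
      Submodule.eq_bot_iff]
    intro v hv
    apply hd
    intro i
    exact (Submodule.mem_orthogonal _ _).1 hv _ (Submodule.subset_span ⟨i, rfl⟩)
  refine ⟨hdense, ?_⟩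
  let e : (ι →₀ ℂ) →ₗ[ℂ] V := Finsupp.linearCombination ℂ p
  let f : (ι →₀ ℂ) →ₛₗ[starRingEnd ℂ] V :=
    { toFun := fun c => c.sum fun i a => (starRingEnd ℂ a) • q i
      map_add' := fun c d => by
        apply Finsupp.sum_add_index' <;> simp [add_smul]
      map_smul' := fun a c => by
        rw [Finsupp.sum_smul_index' (by simp)]
        simp [Finsupp.smul_sum, mul_smul] }
  have hef : ∀ c, ‖f c‖ ≤ 1 * ‖e c‖ := by
    intro c
    have h1 : ⟪f c, f c⟫ = ⟪e c, e c⟫ := by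
      change ⟪c.sum fun i a => (starRingEnd ℂ a) • q i, c.sum fun i a => (starRingEnd ℂ a) • q i⟫
        = ⟪Finsupp.linearCombination ℂ p c, Finsupp.linearCombination ℂ p c⟫
      rw [Finsupp.linearCombination_apply]
      simp only [Finsupp.sum, sum_inner, inner_sum, inner_smul_left, inner_smul_right, hpq]
      simp only [Finset.mul_sum]
      rw [Finset.sum_comm]
      refine Finset.sum_congr rfl fun i _ => Finset.sum_congr rfl fun j _ => ?_
      simp only [Complex.conj_conj]
      ring
    rw [one_mul, norm_eq_sqrt_re_inner (𝕜 := ℂ), norm_eq_sqrt_re_inner (𝕜 := ℂ) (e c), h1]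
  have hde : DenseRange e := by
    have : Set.range e = (Submodule.span ℂ (Set.range p) : Set V) := by
      rw [← Finsupp.range_linearCombination]; rfl
    rw [DenseRange, this]; exact hdense
  refine ⟨f.extendOfNorm e, fun i => ?_⟩
  have := LinearMap.extendOfNorm_eq hde ⟨1, hef⟩ (Finsupp.single i 1)
  simpa [e, f] using this

lemma ext_dense {V W ι : Type*} [NormedAddCommGroup V] [InnerProductSpace ℂ V]
    [NormedAddCommGroup W] [NormedSpace ℂ W]
    (p : ι → V) (hd : Dense (Submodule.span ℂ (Set.range p) : Set V))
    (J J' : V →SL[starRingEnd ℂ] W) (h : ∀ i, J (p i) = J' (p i)) : J = J' := by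
  apply ContinuousLinearMap.ext_on hd
  rintro _ ⟨i, rfl⟩
  exact h i

lemma conjE_conj {n : ℕ} (f : EuclideanSpace ℂ (Fin n) → ℂ) (x : EuclideanSpace ℂ (Fin n))
    (hf : DifferentiableAt ℂ f (conjE n x)) :
    DifferentiableAt ℂ (fun y => (starRingEnd ℂ) (f (conjE n y))) x := by
  let C0 : EuclideanSpace ℂ (Fin n) →ₗ[ℝ] EuclideanSpace ℂ (Fin n) :=
    { toFun := conjE n
      map_add' := fun a b => by ext i; simp [conjE]
      map_smul' := fun a b => by ext i; simp [conjE] }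
  let C := LinearMap.toContinuousLinearMap C0
  have hC : ∀ y, C y = conjE n y := fun y => rfl
  obtain ⟨L, hL⟩ := hf
  have h1 := hL.restrictScalars ℝ
  have h2 : HasFDerivAt (fun y => Complex.conjCLE (f (C y)))
      ((Complex.conjCLE : ℂ →L[ℝ] ℂ).comp ((L.restrictScalars ℝ).comp C)) x :=
    (Complex.conjCLE : ℂ →L[ℝ] ℂ).hasFDerivAt.comp x (h1.comp x C.hasFDerivAt)
  let M : EuclideanSpace ℂ (Fin n) →ₗ[ℂ] ℂ :=
    { toFun := fun y => (starRingEnd ℂ) (L (conjE n y))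
      map_add' := fun a b => by
        rw [← hC, map_add, map_add, map_add, hC, hC]
      map_smul' := fun a b => by
        have : conjE n (a • b) = (starRingEnd ℂ a) • conjE n b := by ext i; simp [conjE]
        simp [this] }
  refine ⟨LinearMap.toContinuousLinearMap M, hasFDerivAt_of_restrictScalars ℝ h2 ?_⟩
  ext y
  rfl

/-- **The adjoint of an intertwiner is `J A J⁻¹`.** Let `𝓥` be a Hilbert space of
holomorphic functions on a nonempty connected open `D ⊆ ℂⁿ` on which `H` acts unitarily
by translations, and let `σ` be an anti-holomorphic diffeomorphism of `D` preserving every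
`H`-orbit.  Then `(Jf)(x) := conj (f (σ x))` maps `𝓥` bijectively onto itself, and every
continuous intertwiner `A` of `𝓥` satisfies `A* = J ∘ A ∘ J⁻¹`, expressed below in the
equivalent form `A* (J f) = J (A f)` for all `f`. -/
theorem adjoint_eq_JAJinv
    {n : ℕ} (D : Set (EuclideanSpace ℂ (Fin n)))
    (hD_open : IsOpen D) (hD_conn : IsConnected D)
    {H : Type*} [Group H] [MulAction H (EuclideanSpace ℂ (Fin n))]
    (hact_maps : ∀ h : H, Set.MapsTo (fun x => h • x) D D)
    (hact_hol : ∀ h : H, DifferentiableOn ℂ (fun x => h • x) D)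
    {𝓥 : Type*} [NormedAddCommGroup 𝓥] [InnerProductSpace ℂ 𝓥] [CompleteSpace 𝓥]
    (T : 𝓥 →ₗ[ℂ] (EuclideanSpace ℂ (Fin n) → ℂ))
    (hT_inj : ∀ f g : 𝓥, (∀ x ∈ D, T f x = T g x) → f = g)
    (hT_hol : ∀ f : 𝓥, DifferentiableOn ℂ (T f) D)
    (hT_eval : ∀ y ∈ D, Continuous fun f : 𝓥 => T f y)
    (τ : H → 𝓥 →ₗ[ℂ] 𝓥)
    (hτ_eval : ∀ (h : H) (f : 𝓥), ∀ x ∈ D, T (τ h f) x = T f (h⁻¹ • x))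
    (hτ_unitary : ∀ (h : H) (f g : 𝓥), ⟪τ h f, τ h g⟫ = ⟪f, g⟫)
    (hτ_surj : ∀ h : H, Function.Surjective (τ h))
    (σ σinv : EuclideanSpace ℂ (Fin n) → EuclideanSpace ℂ (Fin n))
    (hσ_maps : Set.MapsTo σ D D) (hσinv_maps : Set.MapsTo σinv D D)
    (hσ_left : ∀ x ∈ D, σinv (σ x) = x) (hσ_right : ∀ x ∈ D, σ (σinv x) = x)
    (hσ_anti : DifferentiableOn ℂ (fun x => conjE n (σ x)) D)
    (hσinv_anti : DifferentiableOn ℂ (fun x => conjE n (σinv x)) D)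
    (hσ_orbit : ∀ x ∈ D, ∃ h : H, σ x = h • x) :
    ∃ J : 𝓥 → 𝓥,
      (∀ f : 𝓥, ∀ x ∈ D, T (J f) x = (starRingEnd ℂ) (T f (σ x))) ∧
      Function.Bijective J ∧
      ∀ A : 𝓥 →L[ℂ] 𝓥, (∀ (h : H) (f : 𝓥), A (τ h f) = τ h (A f)) →
        ∀ f : 𝓥, ContinuousLinearMap.adjoint A (J f) = J (A f) := by
  have hkex : ∀ y, ∃ v : 𝓥, y ∈ D → ∀ f, ⟪v, f⟫ = T f y := by
    intro y
    by_cases hy : y ∈ D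
    · let φ : 𝓥 →L[ℂ] ℂ := ⟨(LinearMap.proj y).comp T, hT_eval y hy⟩
      refine ⟨(InnerProductSpace.toDual ℂ 𝓥).symm φ, fun _ f => ?_⟩
      rw [InnerProductSpace.toDual_symm_apply]; rfl
    · exact ⟨0, fun h => absurd h hy⟩
  choose k hk using hkex
  have hk' : ∀ y ∈ D, ∀ f, ⟪f, k y⟫ = (starRingEnd ℂ) (T f y) := by
    intro y hy f
    rw [← hk y hy, inner_conj_symm]
  have kext : ∀ v w : 𝓥, (∀ x ∈ D, ⟪k x, v⟫ = ⟪k x, w⟫) → v = w := by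
    intro v w h
    apply hT_inj
    intro x hx
    rw [← hk x hx, ← hk x hx, h x hx]
  have hφ : ∀ f, DifferentiableOn ℂ (fun x => (starRingEnd ℂ) (T f (σ x))) D := by
    intro f x hx
    have hcc : ∀ z, conjE n (conjE n z) = z := by intro z; ext i; simp [conjE]
    have h1 : DifferentiableAt ℂ (fun y => (starRingEnd ℂ) (T f (conjE n y))) (conjE n (σ x)) := by
      apply conjE_conj
      rw [hcc]
      exact (hT_hol f).differentiableAt (hD_open.mem_nhds (hσ_maps hx))
    have h2 := hσ_anti.differentiableAt (hD_open.mem_nhds hx)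
    have h3 := DifferentiableAt.comp x h1 h2
    simp only [Function.comp_def, hcc] at h3
    exact h3.differentiableWithinAt
  have hkτ : ∀ (h : H), ∀ x ∈ D, k (h • x) = τ h (k x) := by
    intro h x hx
    apply ext_inner_right ℂ
    intro f
    obtain ⟨g, rfl⟩ := hτ_surj h f
    rw [hτ_unitary, hk _ (hact_maps h hx), hk _ hx, hτ_eval h g _ (hact_maps h hx), inv_smul_smul]
  have ker : ∀ A : 𝓥 →L[ℂ] 𝓥, (∀ (h : H) (f : 𝓥), A (τ h f) = τ h (A f)) →
      ∀ x ∈ D, ∀ y ∈ D, ⟪k x, A (k y)⟫ = ⟪k (σ y), A (k (σ x))⟫ := by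
    intro A hA x hx y hy
    rw [← sub_eq_zero]
    refine sesqui hD_open hD_conn
      (fun x y => ⟪k x, A (k y)⟫ - ⟪k (σ y), A (k (σ x))⟫) ?_ ?_ ?_ ?_ x hx y hy
    · intro y hy
      refine DifferentiableOn.fun_sub ?_ ?_
      · exact (hT_hol (A (k y))).congr fun x hx => hk x hx _
      · refine (hφ (ContinuousLinearMap.adjoint A (k (σ y)))).congr fun x hx => ?_
        rw [← hk' _ (hσ_maps hx), ContinuousLinearMap.adjoint_inner_left]
    · intro x hx
      simp only [map_sub, inner_conj_symm]
      refine DifferentiableOn.fun_sub ?_ ?_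
      · refine (hT_hol (ContinuousLinearMap.adjoint A (k x))).congr fun y hy => ?_
        rw [← hk _ hy, ContinuousLinearMap.adjoint_inner_right]
      · exact (hφ (A (k (σ x)))).congr fun y hy => hk' _ (hσ_maps hy) _
    · intro x y u s hs1 hs2
      let Ω : Set ℂ := {s | x + s • u ∈ D} ∩ {s | y + (starRingEnd ℂ s) • u ∈ D}
      have hc : Continuous (starRingEnd ℂ) := Complex.continuous_conj
      have hΩ : IsOpen Ω :=
        (hD_open.preimage (f := fun s : ℂ => x + s • u) (by fun_prop)).inter
          (hD_open.preimage (f := fun s : ℂ => y + (starRingEnd ℂ s) • u) (by fun_prop))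
      have P1 : ∀ g : EuclideanSpace ℂ (Fin n) → ℂ, DifferentiableOn ℂ g D →
          DifferentiableOn ℂ (fun s : ℂ => g (x + s • u)) Ω := by
        intro g hg
        have hl : Differentiable ℂ (fun s : ℂ => x + s • u) := by fun_prop
        exact hg.comp hl.differentiableOn fun s hs => hs.1
      have P2 : ∀ g : EuclideanSpace ℂ (Fin n) → ℂ, DifferentiableOn ℂ g D →
          DifferentiableOn ℂ (fun s : ℂ => (starRingEnd ℂ) (g (y + (starRingEnd ℂ s) • u))) Ω := by
        intro g hg s hs
        apply DifferentiableAt.differentiableWithinAt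
        have hl : DifferentiableAt ℂ (fun s : ℂ => y + s • u) (starRingEnd ℂ s) := by fun_prop
        have h1 : DifferentiableAt ℂ (fun s : ℂ => g (y + s • u)) (starRingEnd ℂ s) :=
          DifferentiableAt.comp (g := g) (starRingEnd ℂ s)
            (hg.differentiableAt (hD_open.mem_nhds hs.2)) hl
        have h2 := h1.conj_conj
        rw [Complex.conj_conj] at h2
        exact h2
      have hsΩ : s ∈ Ω := ⟨hs1, hs2⟩
      refine DifferentiableAt.fun_sub ?_ ?_
      · apply pair_diff hΩ (fun s => k (x + s • u)) (fun s => k (y + (starRingEnd ℂ s) • u))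
          _ _ A hsΩ
        · exact fun f => (P1 _ (hT_hol f)).congr fun s hs => hk _ hs.1 _
        · exact fun f => (P2 _ (hT_hol f)).congr fun s hs => hk' _ hs.2 _
      · apply pair_diff hΩ (fun s => k (σ (y + (starRingEnd ℂ s) • u)))
          (fun s => k (σ (x + s • u))) _ _ A hsΩ
        · refine fun f => (P2 _ (hφ f)).congr fun s hs => ?_
          rw [Complex.conj_conj]
          exact hk _ (hσ_maps hs.2) _
        · exact fun f => (P1 _ (hφ f)).congr fun s hs => hk' _ (hσ_maps hs.1) _
    · intro x hx
      obtain ⟨h, hh⟩ := hσ_orbit x hx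
      simp only [hh]
      rw [hkτ h x hx, hA, hτ_unitary, sub_self]
  have ker1 : ∀ x ∈ D, ∀ y ∈ D, ⟪k x, k y⟫ = ⟪k (σ y), k (σ x)⟫ :=
    ker (ContinuousLinearMap.id ℂ 𝓥) (fun _ _ => rfl)
  obtain ⟨hd1, J, hJ⟩ := antiunitary (fun w : D => k (σ w)) (fun w : D => k w)
    (fun i j => ker1 i i.2 j j.2) (fun v hv => kext v 0 fun x hx => by
      have := hv ⟨σinv x, hσinv_maps hx⟩
      simp only [hσ_right x hx] at this
      rw [this, inner_zero_right])
  obtain ⟨hd2, J', hJ'⟩ := antiunitary (fun w : D => k w) (fun w : D => k (σ w))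
    (fun i j => (ker1 j j.2 i i.2).symm) (fun v hv => kext v 0 fun x hx => by
      rw [hv ⟨x, hx⟩, inner_zero_right])
  have spec : ∀ f, ∀ x ∈ D, ⟪k x, J f⟫ = ⟪f, k (σ x)⟫ := by
    intro f x hx
    have : (innerSL ℂ (k x)).comp J = (innerSL ℂ).flip (k (σ x)) := by
      refine ext_dense _ hd1 _ _ fun w => ?_
      have h1 := hJ w
      simp only [ContinuousLinearMap.comp_apply, h1, innerSL_apply_apply,
        ContinuousLinearMap.flip_apply]
      exact ker1 x hx w w.2
    have := congrArg (fun L => L f) this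
    simpa using this
  refine ⟨J, ?_, ?_, ?_⟩
  · intro f x hx
    rw [← hk x hx, spec f x hx, hk' _ (hσ_maps hx)]
  · have e1 : J.comp J' = ContinuousLinearMap.id ℂ 𝓥 := by
      apply ContinuousLinearMap.ext_on hd2
      rintro _ ⟨w, rfl⟩
      exact (congrArg J (hJ' w)).trans (hJ w)
    have e2 : J'.comp J = ContinuousLinearMap.id ℂ 𝓥 := by
      apply ContinuousLinearMap.ext_on hd1
      rintro _ ⟨w, rfl⟩
      exact (congrArg J' (hJ w)).trans (hJ' w)
    exact Function.bijective_iff_has_inverse.2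
      ⟨J', fun f => congrArg (fun L => L f) e2, fun f => congrArg (fun L => L f) e1⟩
  · intro A hA f
    have : (ContinuousLinearMap.adjoint A).comp J = J.comp A := by
      refine ext_dense _ hd1 _ _ fun w => ?_
      have h1 := hJ w
      simp only [ContinuousLinearMap.comp_apply, h1]
      apply kext
      intro x hx
      rw [spec _ x hx, ContinuousLinearMap.adjoint_inner_right, ← inner_conj_symm,
        ker A hA w w.2 x hx, inner_conj_symm]
    exact congrArg (fun L => L f) this
end

section
/- Let 𝓗 be a complex Hilbert space, let J : 𝓗 → 𝓗 be a bijective conjugate-linear isometry, and let 𝒜 be a set of continuous ℂ-linear endomorphisms of 𝓗 that is closed under composition and such that every A ∈ 𝒜 satisfies A* = J ∘ A ∘ J⁻¹, where A* is the Hilbert-space adjoint of A. Then 𝒜 is commutative: A ∘ B = B ∘ A for all A, B ∈ 𝒜. -/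
open scoped ComplexInnerProductSpace

/-- **Commutativity criterion via a conjugate-linear isometry.** If `J` is a bijective
conjugate-linear isometry of a complex Hilbert space `𝓗` and `𝒜` is a set of continuous
linear endomorphisms of `𝓗`, closed under composition, such that every `A ∈ 𝒜`
satisfies `A* = J ∘ A ∘ J⁻¹` (equivalently `A* (J v) = J (A v)` for all `v`), then `𝒜`
is commutative. -/
theorem commutative_of_adjoint_JAJinv
    {𝓗 : Type*} [NormedAddCommGroup 𝓗] [InnerProductSpace ℂ 𝓗] [CompleteSpace 𝓗]
    (J : 𝓗 → 𝓗) (hJ_bij : Function.Bijective J)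
    (hJ_add : ∀ u v : 𝓗, J (u + v) = J u + J v)
    (hJ_smul : ∀ (c : ℂ) (v : 𝓗), J (c • v) = (starRingEnd ℂ) c • J v)
    (hJ_norm : ∀ v : 𝓗, ‖J v‖ = ‖v‖)
    (𝒜 : Set (𝓗 →L[ℂ] 𝓗))
    (h_comp : ∀ A ∈ 𝒜, ∀ B ∈ 𝒜, A.comp B ∈ 𝒜)
    (h_adj : ∀ A ∈ 𝒜, ∀ v : 𝓗, ContinuousLinearMap.adjoint A (J v) = J (A v)) :
    ∀ A ∈ 𝒜, ∀ B ∈ 𝒜, A.comp B = B.comp A := by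
  intro A hA B hB
  ext v
  apply hJ_bij.1
  have h := h_adj _ (h_comp A hA B hB) v
  rw [ContinuousLinearMap.adjoint_comp, ContinuousLinearMap.comp_apply, h_adj A hA,
    h_adj B hB] at h
  exact h.symm
end

section
/- Let D be a nonempty connected open subset of ℂ^n and let D* := { conj(z) : z ∈ D }, where conj denotes componentwise complex conjugation. Suppose F is a ℂ-valued function holomorphic on the open set D × D* ⊆ ℂ^n × ℂ^n (i.e., complex differentiable in the 2n complex variables jointly) such that F(z, conj(z)) = 0 for every z ∈ D. Then F(z, w) = 0 for all (z, w) ∈ D × D*. -/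
theorem aux_conjE_conjE {n : ℕ} (z : EuclideanSpace ℂ (Fin n)) : conjE n (conjE n z) = z := by
  ext i; simp [conjE]

theorem aux_conjE_line {n : ℕ} (x y : EuclideanSpace ℂ (Fin n)) (t : ℂ) :
    conjE n (x + t • y) = conjE n x + (starRingEnd ℂ t) • conjE n y := by
  ext i; simp [conjE]

theorem aux_conjE_continuous {n : ℕ} : Continuous (conjE n) := by
  unfold conjE
  refine (PiLp.continuous_toLp 2 _).comp (continuous_pi fun i => ?_)
  exact Complex.continuous_conj.comp (by fun_prop)

theorem aux_image {n : ℕ} (D : Set (EuclideanSpace ℂ (Fin n))) :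
    conjE n '' D = conjE n ⁻¹' D := by
  ext w
  constructor
  · rintro ⟨z, hz, rfl⟩
    simpa [aux_conjE_conjE] using hz
  · intro h
    exact ⟨_, h, aux_conjE_conjE w⟩

theorem aux_identity {E : Type*} [NormedAddCommGroup E] [NormedSpace ℂ E] {U : Set E}
    (hU : IsOpen U) (hc : IsPreconnected U) {f : E → ℂ} (hf : DifferentiableOn ℂ f U)
    {z₀ : E} (hz₀ : z₀ ∈ U) (h0 : ∀ᶠ z in nhds z₀, f z = 0) : ∀ z ∈ U, f z = 0 := by
  have key : U ⊆ {z | ∀ᶠ w in nhds z, f w = 0} := by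
    refine hc.subset_of_closure_inter_subset isOpen_setOfPred_eventually_nhds ⟨z₀, hz₀, h0⟩ ?_
    rintro p ⟨hp, hpU⟩
    obtain ⟨r, hr, hB⟩ := Metric.isOpen_iff.1 hU p hpU
    obtain ⟨a, ha, hap⟩ := Metric.mem_closure_iff.1 hp r hr
    have haB : a ∈ Metric.ball p r := by rwa [Metric.mem_ball, dist_comm]
    filter_upwards [Metric.ball_mem_nhds p hr] with q hq
    let L : ℂ → E := fun t => a + t • (q - a)
    have hL : Differentiable ℂ L := by fun_prop
    let S : Set ℂ := L ⁻¹' Metric.ball p r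
    have hSo : IsOpen S := Metric.isOpen_ball.preimage hL.continuous
    have hSc : Convex ℝ S := by
      intro s hs t ht α β hα hβ hαβ
      have h := convex_ball p r hs ht hα hβ hαβ
      have e : L (α • s + β • t) = α • L s + β • L t := by
        have : a = α • a + β • a := by rw [← add_smul, hαβ, one_smul]
        simp only [L, smul_add, add_smul, smul_assoc]
        nth_rewrite 1 [this]
        abel
      simpa only [S, Set.mem_preimage, e] using h
    have han : AnalyticOnNhd ℂ (f ∘ L) S :=
      ((hf.mono hB).comp hL.differentiableOn (fun t ht => ht)).analyticOnNhd hSo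
    have h0S : (0 : ℂ) ∈ S := by simpa [S, L] using haB
    have h1S : (1 : ℂ) ∈ S := by simpa [S, L] using hq
    have hev : (f ∘ L) =ᶠ[nhds 0] 0 := by
      have : Filter.Tendsto L (nhds 0) (nhds a) := by
        have := hL.continuous.tendsto 0
        simpa [L] using this
      exact this.eventually ha
    have := han.eqOn_zero_of_preconnected_of_eventuallyEq_zero hSc.isPreconnected h0S hev h1S
    simpa [L] using this
  intro z hz
  exact (key hz).self_of_nhds

theorem aux_local {n : ℕ} {D : Set (EuclideanSpace ℂ (Fin n))}
    {F : EuclideanSpace ℂ (Fin n) × EuclideanSpace ℂ (Fin n) → ℂ}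
    (hF : DifferentiableOn ℂ F (D ×ˢ (conjE n '' D)))
    (h_diag : ∀ z ∈ D, F (z, conjE n z) = 0)
    {B : Set (EuclideanSpace ℂ (Fin n))} (hBo : IsOpen B) (hBc : Convex ℝ B) (hBD : B ⊆ D)
    {z w : EuclideanSpace ℂ (Fin n)} (hz : z ∈ B) (hw : conjE n w ∈ B) : F (z, w) = 0 := by
  set x : EuclideanSpace ℂ (Fin n) := (1 / 2 : ℂ) • (z + conjE n w) with hx
  set y : EuclideanSpace ℂ (Fin n) := (-Complex.I / 2) • (z - conjE n w) with hy
  let L : ℂ → EuclideanSpace ℂ (Fin n) := fun t => x + t • y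
  have hL : Differentiable ℂ L := by fun_prop
  let M : ℂ → EuclideanSpace ℂ (Fin n) := fun t => conjE n x + t • conjE n y
  have hM : Differentiable ℂ M := by fun_prop
  have hLM : ∀ t, conjE n (M t) = L (starRingEnd ℂ t) := fun t => by
    simp only [M, L, aux_conjE_line, aux_conjE_conjE]
  have hconv : ∀ (α β : ℝ) (s t : ℂ), α + β = 1 →
      L (α • s + β • t) = α • L s + β • L t := by
    intro α β s t hαβ
    have : x = α • x + β • x := by rw [← add_smul, hαβ, one_smul]
    simp only [L, smul_add, add_smul, smul_assoc]
    nth_rewrite 1 [this]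
    abel
  let S : Set ℂ := L ⁻¹' B ∩ (fun t => L (starRingEnd ℂ t)) ⁻¹' B
  have hSo : IsOpen S := (hBo.preimage hL.continuous).inter
    (hBo.preimage (hL.continuous.comp Complex.continuous_conj))
  have hSc : Convex ℝ S := by
    intro s hs t ht α β hα hβ hαβ
    refine ⟨?_, ?_⟩
    · have h := hBc hs.1 ht.1 hα hβ hαβ
      simpa only [Set.mem_preimage, hconv α β s t hαβ] using h
    · have h := hBc hs.2 ht.2 hα hβ hαβ
      have e : starRingEnd ℂ (α • s + β • t) = α • starRingEnd ℂ s + β • starRingEnd ℂ t := by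
        simp
      simpa only [Set.mem_preimage, e, hconv α β _ _ hαβ] using h
  have hLI : L Complex.I = z := by
    ext i
    simp only [L, hx, hy, PiLp.add_apply, PiLp.smul_apply, PiLp.sub_apply, smul_eq_mul]
    linear_combination (-(z i - conjE n w i) / 2) * Complex.I_mul_I
  have hLI' : L (-Complex.I) = conjE n w := by
    ext i
    simp only [L, hx, hy, PiLp.add_apply, PiLp.smul_apply, PiLp.sub_apply, smul_eq_mul]
    linear_combination ((z i - conjE n w i) / 2) * Complex.I_mul_I
  have hMI : M Complex.I = w := by
    rw [← aux_conjE_conjE (M Complex.I), hLM, Complex.conj_I, hLI', aux_conjE_conjE]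
  have hIS : Complex.I ∈ S := by
    refine ⟨?_, ?_⟩
    · simpa only [Set.mem_preimage, hLI] using hz
    · simpa only [Set.mem_preimage, Complex.conj_I, hLI'] using hw
  have hnIS : -Complex.I ∈ S := by
    refine ⟨?_, ?_⟩
    · simpa only [Set.mem_preimage, hLI'] using hw
    · simpa only [Set.mem_preimage, map_neg, Complex.conj_I, neg_neg, hLI] using hz
  have h0S : (0 : ℂ) ∈ S := by
    have := hSc hIS hnIS (a := 1 / 2) (b := 1 / 2) (by norm_num) (by norm_num) (by norm_num)
    simpa using this
  have han : AnalyticOnNhd ℂ (fun t => F (L t, M t)) S := by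
    refine DifferentiableOn.analyticOnNhd ?_ hSo
    refine hF.comp (f := fun t => (L t, M t)) (hL.prodMk hM).differentiableOn ?_
    intro t ht
    refine ⟨hBD ht.1, ?_⟩
    rw [aux_image, Set.mem_preimage, hLM]
    exact hBD ht.2
  have hreal : ∀ s : ℝ, (s : ℂ) ∈ S → F (L s, M s) = 0 := by
    intro s hs
    have : M s = conjE n (L s) := by
      rw [← aux_conjE_conjE (M s), hLM, Complex.conj_ofReal]
    rw [this]
    exact h_diag _ (hBD hs.1)
  have hfreq : ∃ᶠ t in nhdsWithin (0 : ℂ) {0}ᶜ, F (L t, M t) = 0 := by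
    have ht : Filter.Tendsto (fun s : ℝ => (s : ℂ)) (nhdsWithin 0 {0}ᶜ)
        (nhdsWithin (0 : ℂ) {0}ᶜ) := by
      refine tendsto_nhdsWithin_iff.2 ⟨?_, ?_⟩
      · have := Complex.continuous_ofReal.tendsto 0
        exact (by simpa using this : Filter.Tendsto _ _ _).mono_left nhdsWithin_le_nhds
      · filter_upwards [self_mem_nhdsWithin] with s hs
        simpa using hs
    refine ht.frequently (Filter.Eventually.frequently ?_)
    have hS : S ∈ nhdsWithin (0 : ℂ) {0}ᶜ := mem_nhdsWithin_of_mem_nhds (hSo.mem_nhds h0S)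
    filter_upwards [ht hS] with s hs using hreal s hs
  have := han.eqOn_zero_of_preconnected_of_frequently_eq_zero hSc.isPreconnected h0S hfreq hIS
  simpa only [hLI, hMI, Pi.zero_apply] using this


/-- **Unicity theorem along the totally real diagonal.** Let `D ⊆ ℂⁿ` be a nonempty
connected open set and `D* := conj '' D`.  If `F` is holomorphic on `D × D* ⊆ ℂⁿ × ℂⁿ`
and `F (z, conj z) = 0` for every `z ∈ D`, then `F ≡ 0` on `D × D*`. -/
theorem unicity_along_totally_real_diagonal
    {n : ℕ} (D : Set (EuclideanSpace ℂ (Fin n)))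
    (hD_open : IsOpen D) (hD_conn : IsConnected D)
    (F : EuclideanSpace ℂ (Fin n) × EuclideanSpace ℂ (Fin n) → ℂ)
    (hF : DifferentiableOn ℂ F (D ×ˢ (conjE n '' D)))
    (h_diag : ∀ z ∈ D, F (z, conjE n z) = 0) :
    ∀ p ∈ D ×ˢ (conjE n '' D), F p = 0 := by
  obtain ⟨z₀, hz₀⟩ := hD_conn.nonempty
  have hopen : IsOpen (conjE n '' D) := by
    rw [aux_image]; exact hD_open.preimage aux_conjE_continuous
  have hconn : IsPreconnected (conjE n '' D) :=
    hD_conn.isPreconnected.image _ aux_conjE_continuous.continuousOn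
  refine aux_identity (hD_open.prod hopen) (hD_conn.isPreconnected.prod hconn) hF
    (z₀ := (z₀, conjE n z₀)) ⟨hz₀, z₀, hz₀, rfl⟩ ?_
  obtain ⟨r, hr, hB⟩ := Metric.isOpen_iff.1 hD_open z₀ hz₀
  have h1 : ∀ᶠ z in nhds z₀, z ∈ Metric.ball z₀ r := Metric.ball_mem_nhds z₀ hr
  have h2 : ∀ᶠ w in nhds (conjE n z₀), conjE n w ∈ Metric.ball z₀ r := by
    have := aux_conjE_continuous.tendsto (conjE n z₀)
    rw [aux_conjE_conjE] at this
    exact this.eventually h1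
  filter_upwards [h1.prod_nhds h2] with p hp
  exact aux_local hF h_diag Metric.isOpen_ball (convex_ball _ _) hB hp.1 hp.2
end
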